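/- If the family of polynomials computable by polynomial-size arithmetic formulas is closed under the operation f ↦ per(M) for polynomial-size bounded-treewidth matrices M with entries 0, 1, or variables, then the three classes — (a) polynomials with polynomial-size formulas, (b) permanents of polynomial-size bounded-treewidth matrices with variable/constant entries, (c) hamiltonians of polynomial-size bounded-treewidth matrices with variable/constant entries — coincide. -/

import Mathlib

open scoped Classical

/-! ### Arithmetic formulas -/

inductive Formula (K : Type) (ν : Type) where
  | const : K → Formula K ν
  | var : ν → Formula K ν
  | add : Formula K ν → Formula K ν → Formula K ν
  | mul : Formula K ν → Formula K ν → Formula K ν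

namespace Formula
variable {K ν : Type}

/-- Number of gates of a formula. -/
def size : Formula K ν → ℕ
  | const _ => 1
  | var _ => 1
  | add f g => f.size + g.size + 1
  | mul f g => f.size + g.size + 1

/-- Depth of a formula: longest path from an input to the output. -/
def depth : Formula K ν → ℕ
  | const _ => 0
  | var _ => 0
  | add f g => max f.depth g.depth + 1
  | mul f g => max f.depth g.depth + 1

def eval [CommRing K] (x : ν → K) : Formula K ν → K
  | const c => c
  | var v => x v
  | add f g => f.eval x + g.eval x
  | mul f g => f.eval x * g.eval x

/-- The polynomial computed by a formula. -/
noncomputable def toPoly [CommRing K] : Formula K ν → MvPolynomial ν K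
  | const c => MvPolynomial.C c
  | var v => MvPolynomial.X v
  | add f g => f.toPoly + g.toPoly
  | mul f g => f.toPoly * g.toPoly

/-- The set of variables appearing in a formula. -/
def varSet : Formula K ν → Set ν
  | const _ => ∅
  | var v => {v}
  | add f g => f.varSet ∪ g.varSet
  | mul f g => f.varSet ∪ g.varSet

/-- All constants of the formula are 0 or 1. -/
def ZeroOneConsts [Zero K] [One K] : Formula K ν → Prop
  | const c => c = 0 ∨ c = 1
  | var _ => True
  | add f g => f.ZeroOneConsts ∧ g.ZeroOneConsts
  | mul f g => f.ZeroOneConsts ∧ g.ZeroOneConsts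

end Formula

/-! ### Arithmetic circuits -/

inductive CGate (K ν : Type) (n : ℕ) where
  | const : K → CGate K ν n
  | var : ν → CGate K ν n
  | add : Fin n → Fin n → CGate K ν n
  | mul : Fin n → Fin n → CGate K ν n

def CGate.IsInput {K ν : Type} {n : ℕ} : CGate K ν n → Prop
  | .const _ => True
  | .var _ => True
  | _ => False

/-- An arithmetic circuit: an acyclic digraph of gates, the last gate being the output. -/
structure Circuit (K ν : Type) where
  size : ℕ
  pos : 0 < size
  gate : Fin size → CGate K ν size
  wf : ∀ i a b, (gate i = .add a b ∨ gate i = .mul a b) → a < i ∧ b < i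

namespace Circuit
variable {K ν : Type}

def output (c : Circuit K ν) : Fin c.size := ⟨c.size - 1, Nat.sub_lt c.pos Nat.one_pos⟩

def evalGate {R : Type} [CommRing R] (c : Circuit K ν) (cst : K → R) (x : ν → R) :
    Fin c.size → R := fun i =>
  match h : c.gate i with
  | .const a => cst a
  | .var v => x v
  | .add a b =>
      have hlt := c.wf i a b (Or.inl h)
      c.evalGate cst x a + c.evalGate cst x b
  | .mul a b =>
      have hlt := c.wf i a b (Or.inr h)
      c.evalGate cst x a * c.evalGate cst x b
termination_by i => i.1
decreasing_by
  · exact hlt.1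
  · exact hlt.2
  · exact hlt.1
  · exact hlt.2

/-- The value computed (at the output gate) by a circuit. -/
def eval {R : Type} [CommRing R] (c : Circuit K ν) (cst : K → R) (x : ν → R) : R :=
  c.evalGate cst x c.output

/-- The polynomial computed by a circuit. -/
noncomputable def evalP [CommRing K] (c : Circuit K ν) : MvPolynomial ν K :=
  c.eval MvPolynomial.C MvPolynomial.X

def depthGate (c : Circuit K ν) : Fin c.size → ℕ := fun i =>
  match h : c.gate i with
  | .const _ => 0
  | .var _ => 0
  | .add a b =>
      have hlt := c.wf i a b (Or.inl h)
      max (c.depthGate a) (c.depthGate b) + 1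
  | .mul a b =>
      have hlt := c.wf i a b (Or.inr h)
      max (c.depthGate a) (c.depthGate b) + 1
termination_by i => i.1
decreasing_by
  · exact hlt.1
  · exact hlt.2
  · exact hlt.1
  · exact hlt.2

/-- Depth of a circuit: length of the longest input-to-output path. -/
def depth (c : Circuit K ν) : ℕ := c.depthGate c.output

/-- A circuit is skew if every multiplication gate has at least one argument
which is an input gate. -/
def IsSkew (c : Circuit K ν) : Prop :=
  ∀ i a b, c.gate i = .mul a b → (c.gate a).IsInput ∨ (c.gate b).IsInput

/-- `arrow j i` : there is an arrow from gate `j` to gate `i`. -/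
def arrow (c : Circuit K ν) (j i : Fin c.size) : Prop :=
  ∃ a b, (c.gate i = .add a b ∨ c.gate i = .mul a b) ∧ (j = a ∨ j = b)

/-- The subcircuit rooted at `g` is connected to the rest of the circuit only through
the arrow from `g` to `i`. -/
def OnlyConn (c : Circuit K ν) (g i : Fin c.size) : Prop :=
  ∀ j, Relation.ReflTransGen c.arrow j g →
    ∀ k, c.arrow j k → Relation.ReflTransGen c.arrow k g ∨ (j = g ∧ k = i)

/-- A circuit is weakly skew if for every multiplication gate, at least one of the incoming
arrows comes from an input gate or from a subcircuit whose only connection to the rest of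
the circuit is through this arrow. -/
def IsWeaklySkew (c : Circuit K ν) : Prop :=
  ∀ i a b, c.gate i = .mul a b →
    ((c.gate a).IsInput ∨ c.OnlyConn a i) ∨ ((c.gate b).IsInput ∨ c.OnlyConn b i)

end Circuit

/-! ### Treewidth -/

/-- `G` admits a tree-decomposition of width at most `k`. -/
def HasTreewidthAtMost {V : Type} (G : SimpleGraph V) (k : ℕ) : Prop :=
  ∃ (n : ℕ) (T : SimpleGraph (Fin n)) (X : Fin n → Finset V),
    T.IsTree ∧
    (∀ t, (X t).card ≤ k + 1) ∧
    (∀ v : V, ∃ t, v ∈ X t) ∧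
    (∀ u v : V, G.Adj u v → ∃ t, u ∈ X t ∧ v ∈ X t) ∧
    (∀ v : V, (T.induce {t | v ∈ X t}).Connected)

/-- The underlying undirected simple graph of a digraph (loops discarded). -/
def underlyingGraph {V : Type} (E : V → V → Prop) : SimpleGraph V :=
  SimpleGraph.fromRel E

/-- The underlying undirected graph of the support digraph `G_M` of a matrix. -/
def supportGraph {m : ℕ} {R : Type} [Zero R] (M : Matrix (Fin m) (Fin m) R) :
    SimpleGraph (Fin m) :=
  SimpleGraph.fromRel (fun i j => M i j ≠ 0)

/-! ### Permanent, hamiltonian, cycle covers -/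

/-- The permanent of a square matrix. -/
def perm {m : ℕ} {R : Type} [CommRing R] (M : Matrix (Fin m) (Fin m) R) : R :=
  ∑ σ : Equiv.Perm (Fin m), ∏ i, M i (σ i)

/-- The hamiltonian polynomial of a square matrix: sum over permutations that are a
single cycle on all of `Fin m`. -/
noncomputable def ham {m : ℕ} {R : Type} [CommRing R] (M : Matrix (Fin m) (Fin m) R) : R :=
  ∑ σ ∈ Finset.univ.filter
      (fun σ : Equiv.Perm (Fin m) => σ.IsCycle ∧ σ.support = Finset.univ),
    ∏ i, M i (σ i)

/-- A cycle cover of the digraph with edge relation `E`: a set of edges of `E` forming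
vertex-disjoint directed cycles (loops allowed) covering every vertex exactly once,
i.e. every vertex has exactly one outgoing and exactly one incoming edge in `C`. -/
def IsCycleCover {V : Type} (E : V → V → Prop) (C : Finset (V × V)) : Prop :=
  (∀ e ∈ C, E e.1 e.2) ∧ (∀ v : V, ∃! u, (v, u) ∈ C) ∧ (∀ v : V, ∃! u, (u, v) ∈ C)

/-- The sum of weights of all cycle covers. -/
noncomputable def cycleCoverSum {V K : Type} [Fintype V] [DecidableEq V] [CommRing K]
    (E : V → V → Prop) (w : V → V → K) : K :=
  ∑ C : Finset (V × V), if IsCycleCover E C then ∏ e ∈ C, w e.1 e.2 else 0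

/-! ### Weighted DAGs and path sums -/

/-- The weight of a path (given as the list of its vertices). -/
def pathWeight {V K : Type} [CommRing K] (w : V → V → K) (l : List V) : K :=
  ((l.zip l.tail).map fun p => w p.1 p.2).prod

/-- `l` is (the vertex list of) a directed path from `s` to `t`. -/
def IsPathFromTo {V : Type} (E : V → V → Prop) (s t : V) (l : List V) : Prop :=
  l.Chain' E ∧ l.head? = some s ∧ l.getLast? = some t

/-- The sum of the weights of all directed paths from `s` to `t`. -/
noncomputable def SW {V K : Type} [Fintype V] [DecidableEq V] [CommRing K]
    (E : V → V → Prop) (w : V → V → K) (s t : V) : K :=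
  ∑ l : {l : List V // l.Nodup},
    if IsPathFromTo E s t l.1 then pathWeight w l.1 else 0

/-- A digraph is acyclic if it has no directed cycle (in particular no loop). -/
def Acyclic {V : Type} (E : V → V → Prop) : Prop :=
  ∀ v : V, ¬ Relation.TransGen E v v

/-! ### Perfect matchings, SPM, planarity -/

/-- `M` is (the edge set of) a perfect matching of `G`. -/
def IsPerfectMatchingSet {V : Type} (G : SimpleGraph V) (M : Finset (Sym2 V)) : Prop :=
  (∀ e ∈ M, e ∈ G.edgeSet) ∧ ∀ v : V, ∃! e, e ∈ M ∧ v ∈ e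

/-- The sum of the weights of all perfect matchings of `G`. -/
noncomputable def SPM {V K : Type} [Fintype V] [DecidableEq V] [CommRing K]
    (G : SimpleGraph V) (w : Sym2 V → K) : K :=
  ∑ M : Finset (Sym2 V), if IsPerfectMatchingSet G M then ∏ e ∈ M, w e else 0

/-- A graph is planar if it has a drawing in the plane: vertices are mapped to distinct
points, edges to simple arcs joining their endpoints, arcs meet vertices only at their
endpoints, and two arcs of distinct edges do not meet except possibly at endpoints. -/
def IsPlanar {V : Type} (G : SimpleGraph V) : Prop :=
  ∃ (f : V → ℝ × ℝ) (γ : ∀ u v : V, G.Adj u v → Path (f u) (f v)),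
    Function.Injective f ∧
    (∀ u v h, Function.Injective fun t : unitInterval => (γ u v h) t) ∧
    (∀ u v h (t : unitInterval), t ≠ 0 → t ≠ 1 → ∀ x : V, (γ u v h) t ≠ f x) ∧
    (∀ u v h u' v' h', s(u, v) ≠ s(u', v') →
      ∀ (t t' : unitInterval), t ≠ 0 → t ≠ 1 → t' ≠ 0 → t' ≠ 1 →
        (γ u v h) t ≠ (γ u' v' h') t')


variable (K : Type) [Field K]

/-- Families of polynomials computable by polynomial size formulas. -/
def FormulaClass (f : ℕ → MvPolynomial ℕ K) : Prop :=
  ∃ c : ℕ, ∀ n, ∃ φ : Formula K ℕ, φ.size ≤ c * (n + 1) ^ c ∧ φ.toPoly = f n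

/-- Families expressible as permanents of polynomial size, bounded treewidth matrices
with entries constants or variables. -/
def PermClass (f : ℕ → MvPolynomial ℕ K) : Prop :=
  ∃ c k : ℕ, ∀ n, ∃ m : ℕ, m ≤ c * (n + 1) ^ c ∧
    ∃ M : Matrix (Fin m) (Fin m) (MvPolynomial ℕ K),
      (∀ i j, (∃ a : K, M i j = MvPolynomial.C a) ∨ ∃ v, M i j = MvPolynomial.X v) ∧
      HasTreewidthAtMost (supportGraph M) k ∧
      perm M = f n

/-- Families expressible as hamiltonians of polynomial size, bounded treewidth matrices
with entries constants or variables. -/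
def HamClass (f : ℕ → MvPolynomial ℕ K) : Prop :=
  ∃ c k : ℕ, ∀ n, ∃ m : ℕ, m ≤ c * (n + 1) ^ c ∧
    ∃ M : Matrix (Fin m) (Fin m) (MvPolynomial ℕ K),
      (∀ i j, (∃ a : K, M i j = MvPolynomial.C a) ∨ ∃ v, M i j = MvPolynomial.X v) ∧
      HasTreewidthAtMost (supportGraph M) k ∧
      ham M = f n

/-- Families expressible as permanents of polynomial size, bounded treewidth matrices
with entries 0, 1 or variables. -/
def Perm01Class (f : ℕ → MvPolynomial ℕ K) : Prop :=
  ∃ c k : ℕ, ∀ n, ∃ m : ℕ, m ≤ c * (n + 1) ^ c ∧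
    ∃ M : Matrix (Fin m) (Fin m) (MvPolynomial ℕ K),
      (∀ i j, M i j = 0 ∨ M i j = 1 ∨ ∃ v, M i j = MvPolynomial.X v) ∧
      HasTreewidthAtMost (supportGraph M) k ∧
      perm M = f n

/-! ### Self-maps acting cyclically on a finite set -/

/-- `f` maps `U` to itself and every element of `U` is reachable from every other one
by iterating `f`. -/
def MapCyclicOn {V : Type} (U : Finset V) (f : V → V) : Prop :=
  (∀ u ∈ U, f u ∈ U) ∧
    ∀ u ∈ U, ∀ v ∈ U, Relation.ReflTransGen (fun a b => b = f a) u v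

/-- `f` maps `U` injectively to itself. -/
def MapPermOn {V : Type} (U : Finset V) (f : V → V) : Prop :=
  (∀ u ∈ U, f u ∈ U) ∧ Set.InjOn f U

/-- Short-circuit the point `b` of the functional graph of `f`. -/
def bypass {V : Type} [DecidableEq V] (b : V) (f : V → V) : V → V :=
  fun u => if f u = b then f b else f u

theorem MapCyclicOn.congr {V : Type} {U : Finset V} {f g : V → V}
    (h : ∀ u ∈ U, f u = g u) (hf : MapCyclicOn U f) : MapCyclicOn U g := by
  refine ⟨fun u hu => h u hu ▸ hf.1 u hu, fun u hu v hv => ?_⟩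
  have key : ∀ z, Relation.ReflTransGen (fun a b => b = f a) u z →
      z ∈ U ∧ Relation.ReflTransGen (fun a b => b = g a) u z := by
    intro z hz
    induction hz with
    | refl => exact ⟨hu, .refl⟩
    | tail _ hbc ih =>
      subst hbc
      exact ⟨hf.1 _ ih.1, ih.2.tail (h _ ih.1)⟩
  exact (key v (hf.2 u hu v hv)).2

theorem mapCyclicOn_congr {V : Type} {U : Finset V} {f g : V → V}
    (h : ∀ u ∈ U, f u = g u) : MapCyclicOn U f ↔ MapCyclicOn U g :=
  ⟨fun hf => hf.congr h, fun hg => hg.congr fun u hu => (h u hu).symm⟩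

theorem MapCyclicOn.exists_preimage {V : Type} {U : Finset V} {f : V → V}
    (hf : MapCyclicOn U f) {v : V} (hv : v ∈ U) : ∃ u ∈ U, f u = v := by
  have key : ∀ z, Relation.ReflTransGen (fun a b => b = f a) (f v) z →
      z ∈ U ∧ ∃ u ∈ U, f u = z := by
    intro z hz
    induction hz with
    | refl => exact ⟨hf.1 v hv, v, hv, rfl⟩
    | tail _ hbc ih =>
      subst hbc
      exact ⟨hf.1 _ ih.1, _, ih.1, rfl⟩
  exact (key v (hf.2 _ (hf.1 v hv) v hv)).2

theorem MapCyclicOn.mapPermOn {V : Type} {U : Finset V} {f : V → V}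
    (hf : MapCyclicOn U f) : MapPermOn U f := by
  refine ⟨hf.1, ?_⟩
  refine Finset.injOn_of_surjOn_of_card_le (t := U) f (fun u hu => hf.1 u hu) ?_ le_rfl
  intro v hv
  obtain ⟨u, hu, h⟩ := hf.exists_preimage hv
  exact ⟨u, hu, h⟩

theorem MapPermOn.exists_preimage {V : Type} {U : Finset V} {f : V → V}
    (hf : MapPermOn U f) {v : V} (hv : v ∈ U) : ∃ u ∈ U, f u = v := by
  have := Finset.surjOn_of_injOn_of_card_le (s := U) (t := U) f (fun u hu => hf.1 u hu) hf.2 le_rfl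
  obtain ⟨u, hu, h⟩ := this hv
  exact ⟨u, hu, h⟩

theorem mapCyclicOn_insert {V : Type} [DecidableEq V] {U : Finset V} {b : V} (hb : b ∉ U)
    (hU : U.Nonempty) (f : V → V) :
    MapCyclicOn (insert b U) f ↔ (∃ u ∈ U, f u = b) ∧ MapCyclicOn U (bypass b f) := by
  constructor
  · intro hf
    have hpre : ∃ u ∈ U, f u = b := by
      obtain ⟨u, hu⟩ := hU
      have hne : ∀ z, Relation.ReflTransGen (fun a b => b = f a) u z →
          (z ∈ U ∨ ∃ u ∈ U, f u = b) := by
        intro z hz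
        induction hz with
        | refl => exact .inl hu
        | tail _ hbc ih =>
          subst hbc
          rcases ih with ih | ih
          · rcases Finset.mem_insert.1 (hf.1 _ (Finset.mem_insert_of_mem ih)) with h | h
            · exact .inr ⟨_, ih, h⟩
            · exact .inl h
          · exact .inr ih
      exact (hne b (hf.2 u (Finset.mem_insert_of_mem hu) b
        (Finset.mem_insert_self _ _))).resolve_left hb
    have hinj := hf.mapPermOn.2
    have hfb : f b ∈ U := by
      rcases Finset.mem_insert.1 (hf.1 b (Finset.mem_insert_self _ _)) with h | h
      · obtain ⟨u, hu, hub⟩ := hpre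
        have := hinj (Finset.mem_coe.2 (Finset.mem_insert_of_mem hu))
          (Finset.mem_coe.2 (Finset.mem_insert_self b U)) (hub.trans h.symm)
        exact absurd (this ▸ hu) hb
      · exact h
    refine ⟨hpre, fun u hu => ?_, fun u hu v hv => ?_⟩
    · unfold bypass
      split_ifs with h
      · exact hfb
      · exact (Finset.mem_insert.1 (hf.1 u (Finset.mem_insert_of_mem hu))).resolve_left h
    · have key : ∀ z, Relation.ReflTransGen (fun a b => b = f a) u z →
          (z ∈ U ∧ Relation.ReflTransGen (fun a c => c = bypass b f a) u z) ∨
          (z = b ∧ Relation.ReflTransGen (fun a c => c = bypass b f a) u (f b)) := by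
        intro z hz
        induction hz with
        | refl => exact .inl ⟨hu, .refl⟩
        | @tail c d _ hbc ih =>
          subst hbc
          rcases ih with ⟨hc, ih⟩ | ⟨hc, ih⟩
          · by_cases h : f c = b
            · exact .inr ⟨h, ih.tail (by simp [bypass, h])⟩
            · refine .inl ⟨?_, ih.tail (by simp [bypass, h])⟩
              exact (Finset.mem_insert.1 (hf.1 c (Finset.mem_insert_of_mem hc))).resolve_left h
          · subst hc
            exact .inl ⟨hfb, ih⟩
      rcases key v (hf.2 u (Finset.mem_insert_of_mem hu) v (Finset.mem_insert_of_mem hv)) with h | h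
      · exact h.2
      · exact absurd (h.1 ▸ hv) hb
  · rintro ⟨⟨a, ha, hab⟩, hf⟩
    have hfb : f b ∈ U := by simpa [bypass, hab] using hf.1 a ha
    have key : ∀ u ∈ U, ∀ z, Relation.ReflTransGen (fun a c => c = bypass b f a) u z →
        z ∈ U ∧ Relation.ReflTransGen (fun a c => c = f a) u z := by
      intro u hu z hz
      induction hz with
      | refl => exact ⟨hu, .refl⟩
      | @tail c d _ hbc ih =>
        subst hbc
        refine ⟨hf.1 _ ih.1, ?_⟩
        by_cases h : f c = b
        · have : Relation.ReflTransGen (fun a c => c = f a) u b := ih.2.tail h.symm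
          simpa [bypass, h] using this.tail rfl
        · exact ih.2.tail (by simp [bypass, h])
    have key' : ∀ u ∈ U, ∀ v ∈ insert b U, Relation.ReflTransGen (fun a c => c = f a) u v := by
      intro u hu v hv
      rcases Finset.mem_insert.1 hv with rfl | hv
      · exact (key u hu a (hf.2 u hu a ha)).2.tail hab.symm
      · exact (key u hu v (hf.2 u hu v hv)).2
    refine ⟨fun u hu => ?_, fun u hu v hv => ?_⟩
    · rcases Finset.mem_insert.1 hu with rfl | hu
      · exact Finset.mem_insert_of_mem hfb
      · by_cases h : f u = b
        · simp [h]
        · have := hf.1 u hu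
          simp only [bypass, h, if_false] at this
          exact Finset.mem_insert_of_mem this
    · rcases Finset.mem_insert.1 hu with rfl | hu
      · exact (Relation.ReflTransGen.single (r := fun a c => c = f a) rfl).trans
          (key' _ hfb v hv)
      · exact key' u hu v hv

/-! ### Weighted sums over self-maps -/

/-- Self-maps that fix everything outside of `U` and satisfy `P U`. -/
noncomputable def selfMaps {V : Type} [Fintype V] [DecidableEq V]
    (P : Finset V → (V → V) → Prop) (U : Finset V) : Finset (V → V) :=
  Finset.univ.filter fun f => (∀ v ∉ U, f v = v) ∧ P U f

/-- The sum of the weights of the self-maps in `selfMaps P U`. -/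
noncomputable def mapSum {V R : Type} [Fintype V] [DecidableEq V] [CommRing R]
    (P : Finset V → (V → V) → Prop) (U : Finset V) (M : V → V → R) : R :=
  ∑ f ∈ selfMaps P U, ∏ v ∈ U, M v (f v)

/-- The map obtained from `g` by inserting `w` right after `a`. -/
def insertAfter {V : Type} [DecidableEq V] (w a : V) (g : V → V) : V → V :=
  Function.update (Function.update g a w) w (g a)

/-- The properties shared by the predicates `MapCyclicOn` and `MapPermOn`. -/
structure IsInsertable {V : Type} [DecidableEq V] (P : Finset V → (V → V) → Prop) : Prop where
  mapPermOn : ∀ {U f}, P U f → MapPermOn U f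
  congr : ∀ {U f g}, (∀ u ∈ U, f u = g u) → P U f → P U g
  insert_iff : ∀ {U : Finset V} {w a : V} {g : V → V}, w ∉ U → a ∈ U → (∀ u ∈ U, g u ∈ U) →
    (P (insert w U) (insertAfter w a g) ↔ P U g)
  singleton : ∀ {u : V} {f : V → V}, f u = u → P {u} f

theorem isInsertable_mapCyclicOn {V : Type} [DecidableEq V] :
    IsInsertable (V := V) MapCyclicOn where
  mapPermOn := MapCyclicOn.mapPermOn
  congr := MapCyclicOn.congr
  insert_iff := by
    intro U w a g hw ha hg
    have haw : a ≠ w := fun h => hw (h ▸ ha)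
    rw [mapCyclicOn_insert hw ⟨a, ha⟩]
    have : ∃ u ∈ U, insertAfter w a g u = w := ⟨a, ha, by simp [insertAfter, haw]⟩
    simp only [this, true_and]
    refine mapCyclicOn_congr fun u hu => ?_
    have huw : u ≠ w := fun h => hw (h ▸ hu)
    by_cases hua : u = a
    · subst hua
      simp [bypass, insertAfter, huw]
    · have : g u ≠ w := fun h => hw (h ▸ hg u hu)
      simp [bypass, insertAfter, huw, hua, this]
  singleton := by
    intro u f hf
    refine ⟨by simp [hf], ?_⟩
    intro a ha b hb
    rw [Finset.mem_singleton.1 ha, Finset.mem_singleton.1 hb]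

theorem isInsertable_mapPermOn {V : Type} [DecidableEq V] :
    IsInsertable (V := V) MapPermOn where
  mapPermOn := id
  congr := fun h hf => ⟨fun u hu => h u hu ▸ hf.1 u hu, hf.2.congr fun u hu => h u hu⟩
  insert_iff := by
    intro U w a g hw ha hg
    have haw : a ≠ w := fun h => hw (h ▸ ha)
    have hne : ∀ u ∈ U, u ≠ w := fun u hu h => hw (h ▸ hu)
    have hgne : ∀ u ∈ U, g u ≠ w := fun u hu => hne _ (hg u hu)
    constructor
    · rintro ⟨-, h2⟩
      refine ⟨hg, fun u hu v hv huv => ?_⟩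
      have hu' : u ∈ U := hu
      have hv' : v ∈ U := hv
      by_cases hua : u = a <;> by_cases hva : v = a
      · rw [hua, hva]
      · have := @h2 w (by simp) v (by simp [hv']) (by
          simp [insertAfter, hne v hv', hva, ← huv, hua])
        exact absurd this.symm (hne v hv')
      · have := @h2 w (by simp) u (by simp [hu']) (by
          simp [insertAfter, hne u hu', hua, huv, hva])
        exact absurd this.symm (hne u hu')
      · exact @h2 u (by simp [hu']) v (by simp [hv']) (by
          simp [insertAfter, hne u hu', hne v hv', hua, hva, huv])
    · rintro ⟨-, h2⟩
      have val : ∀ u ∈ U, insertAfter w a g u = if u = a then w else g u := by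
        intro u hu
        by_cases hua : u = a
        · subst hua; simp [insertAfter, haw]
        · simp [insertAfter, hne u hu, hua]
      have valw : insertAfter w a g w = g a := by simp [insertAfter]
      refine ⟨fun u hu => ?_, fun u hu v hv huv => ?_⟩
      · rcases Finset.mem_insert.1 hu with rfl | hu
        · rw [valw]; exact Finset.mem_insert_of_mem (hg a ha)
        · rw [val u hu]
          split_ifs
          · simp
          · exact Finset.mem_insert_of_mem (hg u hu)
      · rcases Finset.mem_insert.1 (Finset.mem_coe.1 hu) with huw | hu' <;>
          rcases Finset.mem_insert.1 (Finset.mem_coe.1 hv) with hvw | hv'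
        · rw [huw, hvw]
        · rw [huw, valw, val v hv'] at huv
          split_ifs at huv with h
          · exact absurd huv (hgne a ha)
          · exact absurd (h2 ha hv' huv).symm h
        · rw [hvw, valw, val u hu'] at huv
          split_ifs at huv with h
          · exact absurd huv.symm (hgne a ha)
          · exact absurd (h2 hu' ha huv) h
        · rw [val u hu', val v hv'] at huv
          split_ifs at huv with h h' h'
          · rw [h, h']
          · exact absurd huv.symm (hgne v hv')
          · exact absurd huv (hgne u hu')
          · exact h2 hu' hv' huv
  singleton := by
    intro u f hf
    exact ⟨by simp [hf], by simp⟩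

/-- Expansion of `mapSum` along one point. -/
theorem mapSum_insert {V R : Type} [Fintype V] [DecidableEq V] [CommRing R]
    {P : Finset V → (V → V) → Prop} (hP : IsInsertable P) {U : Finset V} {w : V} (hw : w ∉ U)
    (M : V → V → R) (hM : M w w = 0) :
    mapSum P (insert w U) M =
      ∑ g ∈ selfMaps P U, ∑ a ∈ U, M a w * M w (g a) * ∏ v ∈ U.erase a, M v (g v) := by
  have hne : ∀ u ∈ U, u ≠ w := fun u hu h => hw (h ▸ hu)
  rw [← Finset.sum_product']
  unfold mapSum
  have hfilter : ∑ f ∈ selfMaps P (insert w U), ∏ v ∈ insert w U, M v (f v) =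
      ∑ f ∈ (selfMaps P (insert w U)).filter (fun f => f w ≠ w),
        ∏ v ∈ insert w U, M v (f v) := by
    refine (Finset.sum_filter_of_ne (p := fun f : V → V => f w ≠ w) fun f _ hf0 hfw => hf0 ?_).symm
    rw [Finset.prod_insert hw, hfw, hM, zero_mul]
  rw [hfilter]
  symm
  refine Finset.sum_bij (fun p _ => insertAfter w p.2 p.1) ?_ ?_ ?_ ?_
  · rintro ⟨g, a⟩ hp
    obtain ⟨hg, ha⟩ := Finset.mem_product.1 hp
    simp only [selfMaps, Finset.mem_filter, Finset.mem_univ, true_and] at hg ⊢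
    have hgm := (hP.mapPermOn hg.2).1
    refine ⟨⟨fun v hv => ?_, (hP.insert_iff hw ha hgm).2 hg.2⟩, ?_⟩
    · have h1 : v ≠ w := fun h => hv (h ▸ Finset.mem_insert_self _ _)
      have h2 : v ≠ a := fun h => hv (h ▸ Finset.mem_insert_of_mem ha)
      simp only [insertAfter, Function.update_of_ne h1, Function.update_of_ne h2]
      exact hg.1 v fun h => hv (Finset.mem_insert_of_mem h)
    · simp only [insertAfter, Function.update_self]
      exact hne _ (hgm a ha)
  · rintro ⟨g, a⟩ hp ⟨g', a'⟩ hp' heq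
    obtain ⟨hg, ha⟩ := Finset.mem_product.1 hp
    obtain ⟨hg', ha'⟩ := Finset.mem_product.1 hp'
    simp only [selfMaps, Finset.mem_filter, Finset.mem_univ, true_and] at hg hg' ha ha' heq
    have hgm' := (hP.mapPermOn hg'.2).1
    have haa : a = a' := by
      by_contra h
      have h1 := congrFun heq a
      simp only [insertAfter, Function.update_of_ne (hne a ha), Function.update_self,
        Function.update_of_ne h] at h1
      exact hne _ (hgm' a ha) h1.symm
    subst haa
    have : g = g' := by
      funext v
      by_cases hvw : v = w
      · subst hvw; rw [hg.1 v hw, hg'.1 v hw]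
      · by_cases hva : v = a
        · subst hva
          have h1 := congrFun heq w
          simpa [insertAfter] using h1
        · have h1 := congrFun heq v
          simpa [insertAfter, hvw, hva] using h1
    rw [this]
  · intro f hf
    simp only [selfMaps, Finset.mem_filter, Finset.mem_univ, true_and] at hf
    obtain ⟨⟨hfix, hPf⟩, hfw⟩ := hf
    have hperm := hP.mapPermOn hPf
    obtain ⟨a, ha, haw⟩ := hperm.exists_preimage (Finset.mem_insert_self w U)
    have ha' : a ≠ w := fun h => hfw (h ▸ haw)
    have haU := (Finset.mem_insert.1 ha).resolve_left ha'
    have hins : insertAfter w a (Function.update (Function.update f a (f w)) w w) = f := by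
      funext v
      by_cases hvw : v = w
      · subst hvw; simp [insertAfter, ha']
      · by_cases hva : v = a
        · subst hva; simp [insertAfter, ha', haw]
        · simp [insertAfter, hvw, hva]
    have hmaps : ∀ u ∈ U, Function.update (Function.update f a (f w)) w w u ∈ U := by
      intro u hu
      rw [Function.update_of_ne (hne u hu)]
      by_cases hua : u = a
      · subst hua
        rw [Function.update_self]
        exact (Finset.mem_insert.1 (hperm.1 w (by simp))).resolve_left hfw
      · rw [Function.update_of_ne hua]
        refine (Finset.mem_insert.1 (hperm.1 u (by simp [hu]))).resolve_left fun h => hua ?_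
        exact hperm.2 (by simp [hu]) (by simp [haU]) (h.trans haw.symm)
    refine ⟨(Function.update (Function.update f a (f w)) w w, a), ?_, hins⟩
    refine Finset.mem_product.2 ⟨?_, haU⟩
    simp only [selfMaps, Finset.mem_filter, Finset.mem_univ, true_and]
    refine ⟨fun v hv => ?_, ?_⟩
    · by_cases hvw : v = w
      · simp [hvw]
      · have hva : v ≠ a := fun h => hv (h ▸ haU)
        rw [Function.update_of_ne hvw, Function.update_of_ne hva]
        exact hfix v (by simp [hvw, hv])
    · rw [← hP.insert_iff hw haU hmaps, hins]
      exact hPf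
  · rintro ⟨g, a⟩ hp
    obtain ⟨hg, ha⟩ := Finset.mem_product.1 hp
    simp only at ha
    rw [Finset.prod_insert hw, ← Finset.mul_prod_erase U _ ha]
    have h1 : ∏ v ∈ U.erase a, M v (insertAfter w a g v) = ∏ v ∈ U.erase a, M v (g v) := by
      refine Finset.prod_congr rfl fun v hv => ?_
      have := Finset.mem_erase.1 hv
      simp [insertAfter, hne v this.2, this.1]
    rw [h1]
    simp [insertAfter, hne a ha]
    ring

/-! ### Local replacements preserving `mapSum` -/

/-- Subdividing all the arrows leaving `x`. -/
theorem mapSum_rowSplit {V R : Type} [Fintype V] [DecidableEq V] [CommRing R]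
    {P : Finset V → (V → V) → Prop} (hP : IsInsertable P) {U : Finset V} {c x : V}
    (hc : c ∉ U) (hx : x ∈ U) {M' M : V → V → R}
    (h1 : ∀ v ∈ insert c U, M' v c = if v = x then 1 else 0) (h2 : ∀ v ∈ U, M' c v = M x v)
    (h3 : ∀ u ∈ U, u ≠ x → ∀ v ∈ U, M' u v = M u v) :
    mapSum P (insert c U) M' = mapSum P U M := by
  have hcx : c ≠ x := fun h => hc (h ▸ hx)
  rw [mapSum_insert hP hc M' (by rw [h1 c (by simp), if_neg hcx])]
  refine Finset.sum_congr rfl fun g hg => ?_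
  simp only [selfMaps, Finset.mem_filter, Finset.mem_univ, true_and] at hg
  have hgm := (hP.mapPermOn hg.2).1
  rw [Finset.sum_eq_single x, h1 x (by simp [hx]), if_pos rfl, h2 _ (hgm x hx), one_mul,
    ← Finset.mul_prod_erase U (fun v => M v (g v)) hx]
  · congr 1
    refine Finset.prod_congr rfl fun v hv => ?_
    have := Finset.mem_erase.1 hv
    exact h3 v this.2 this.1 _ (hgm v this.2)
  · intro a ha hax
    rw [h1 a (by simp [ha]), if_neg hax, zero_mul, zero_mul]
  · exact fun h => absurd hx h

/-- Subdividing all the arrows entering `y`. -/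
theorem mapSum_colSplit {V R : Type} [Fintype V] [DecidableEq V] [CommRing R]
    {P : Finset V → (V → V) → Prop} (hP : IsInsertable P) {U : Finset V} {c y : V}
    (hc : c ∉ U) (hy : y ∈ U) {M' M : V → V → R}
    (h1 : ∀ v ∈ insert c U, M' c v = if v = y then 1 else 0) (h2 : ∀ v ∈ U, M' v c = M v y)
    (h3 : ∀ u ∈ U, ∀ v ∈ U, v ≠ y → M' u v = M u v) :
    mapSum P (insert c U) M' = mapSum P U M := by
  have hcy : c ≠ y := fun h => hc (h ▸ hy)
  rw [mapSum_insert hP hc M' (by rw [h1 c (by simp), if_neg hcy])]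
  refine Finset.sum_congr rfl fun g hg => ?_
  simp only [selfMaps, Finset.mem_filter, Finset.mem_univ, true_and] at hg
  have hperm := hP.mapPermOn hg.2
  have hgm := hperm.1
  obtain ⟨a, ha, hay⟩ := hperm.exists_preimage hy
  rw [Finset.sum_eq_single a, h1 _ (by simp [hgm a ha]), if_pos hay, h2 _ ha, mul_one,
    ← Finset.mul_prod_erase U (fun v => M v (g v)) ha, hay]
  · congr 1
    refine Finset.prod_congr rfl fun v hv => ?_
    have := Finset.mem_erase.1 hv
    refine h3 v this.2 _ (hgm v this.2) fun h => this.1 ?_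
    exact hperm.2 this.2 ha (h.trans hay.symm)
  · intro b hb hba
    have : g b ≠ y := fun h => hba (hperm.2 hb ha (h.trans hay.symm))
    rw [h1 _ (by simp [hgm b hb]), if_neg this, mul_zero, zero_mul]
  · exact fun h => absurd ha h

/-- Replacing an arrow `i → j` of weight `f * g` by a path `i → w → j` with weights `f`, `g`,
where `w` may also be inserted in the middle of the forced arrow `x → y`. -/
theorem mapSum_path {V R : Type} [Fintype V] [DecidableEq V] [CommRing R]
    {P : Finset V → (V → V) → Prop} (hP : IsInsertable P) {U : Finset V} {w i j x y : V}
    (hw : w ∉ U) (hi : i ∈ U) (hx : x ∈ U) (hy : y ∈ U) (hix : i ≠ x) (hjy : j ≠ y)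
    {f g : R} {M' N : V → V → R}
    (hNx : ∀ v ∈ U, N x v = if v = y then 1 else 0)
    (hNy : ∀ v ∈ U, v ≠ x → N v y = 0)
    (hww : M' w w = 0) (hM : ∀ u ∈ U, ∀ v ∈ U, M' u v = N u v)
    (hMw : ∀ u ∈ U, M' u w = (if u = x then 1 else 0) + if u = i then f else 0)
    (hwM : ∀ v ∈ U, M' w v = (if v = y then 1 else 0) + if v = j then g else 0) :
    mapSum P (insert w U) M' =
      mapSum P U (fun u v => N u v + if u = i ∧ v = j then f * g else 0) := by
  rw [mapSum_insert hP hw M' hww]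
  refine Finset.sum_congr rfl fun h hh => ?_
  simp only [selfMaps, Finset.mem_filter, Finset.mem_univ, true_and] at hh
  have hperm := hP.mapPermOn hh.2
  have hm := hperm.1
  have hprod : ∀ a, ∏ v ∈ U.erase a, M' v (h v) = ∏ v ∈ U.erase a, N v (h v) := fun a =>
    Finset.prod_congr rfl fun v hv =>
      hM v (Finset.mem_of_mem_erase hv) _ (hm v (Finset.mem_of_mem_erase hv))
  have hsum : ∑ a ∈ U, M' a w * M' w (h a) * ∏ v ∈ U.erase a, M' v (h v) =
      M' w (h x) * ∏ v ∈ U.erase x, N v (h v) +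
        f * M' w (h i) * ∏ v ∈ U.erase i, N v (h v) := by
    have : ∀ a ∈ U, M' a w * M' w (h a) * ∏ v ∈ U.erase a, M' v (h v) =
        (if a = x then M' w (h a) * ∏ v ∈ U.erase a, N v (h v) else 0) +
        (if a = i then f * M' w (h a) * ∏ v ∈ U.erase a, N v (h v) else 0) := by
      intro a ha
      rw [hMw a ha, hprod]
      split_ifs <;> ring
    rw [Finset.sum_congr rfl this, Finset.sum_add_distrib, Finset.sum_ite_eq' U x,
      Finset.sum_ite_eq' U i, if_pos hx, if_pos hi]
  rw [hsum, hwM _ (hm x hx), hwM _ (hm i hi)]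
  have hrhs : ∏ v ∈ U, (N v (h v) + if v = i ∧ h v = j then f * g else 0) =
      ∏ v ∈ U, N v (h v) + (if h i = j then f * g else 0) * ∏ v ∈ U.erase i, N v (h v) := by
    rw [← Finset.mul_prod_erase U _ hi, ← Finset.mul_prod_erase U (fun v => N v (h v)) hi]
    have : ∏ v ∈ U.erase i, (N v (h v) + if v = i ∧ h v = j then f * g else 0) =
        ∏ v ∈ U.erase i, N v (h v) := by
      refine Finset.prod_congr rfl fun v hv => ?_
      simp [(Finset.mem_erase.1 hv).1]
    rw [this]
    simp only [true_and]
    ring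
  rw [hrhs]
  by_cases hxy : h x = y
  · have hij : h i ≠ y := fun hh' => hix (hperm.2 hi hx (hh'.trans hxy.symm))
    rw [← Finset.mul_prod_erase U (fun v => N v (h v)) hx, hxy, hNx y hy]
    simp only [if_true, if_neg hjy.symm, if_neg hij]
    split_ifs <;> ring
  · have h1 : ∏ v ∈ U.erase x, N v (h v) = 0 := by
      obtain ⟨a, ha, hay⟩ := hperm.exists_preimage hy
      have hax : a ≠ x := fun h' => hxy (h' ▸ hay)
      refine Finset.prod_eq_zero (Finset.mem_erase.2 ⟨hax, ha⟩) ?_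
      rw [hay, hNy a ha hax]
    have h2 : ∏ v ∈ U.erase i, N v (h v) = 0 := by
      refine Finset.prod_eq_zero (Finset.mem_erase.2 ⟨hix.symm, hx⟩) ?_
      rw [hNx _ (hm x hx), if_neg hxy]
    have h3 : ∏ v ∈ U, N v (h v) = 0 := by
      refine Finset.prod_eq_zero hx ?_
      rw [hNx _ (hm x hx), if_neg hxy]
    rw [h1, h2, h3]
    ring

/-! ### Gadgets simulating formulas -/

/-- The matrix whose only possibly nonzero entry is `r`, at position `(a, b)`. -/
def arrowWeight {V R : Type} [DecidableEq V] [Zero R] (a b : V) (r : R) : V → V → R :=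
  fun u v => if u = a ∧ v = b then r else 0

/-- Adding the arrows of `Γ` on the new vertices `N` amounts to adding an arrow `i → j` of weight
`r` and an arrow `x → y` of weight one, for all matrices without other arrows leaving `x` or
entering `y`. -/
def IsGadget {V R : Type} [Fintype V] [DecidableEq V] [CommRing R]
    (P : Finset V → (V → V) → Prop) (i j x y : V) (N : Finset V) (r : R) (Γ : V → V → R) : Prop :=
  ∀ U : Finset V, i ∈ U → j ∈ U → x ∈ U → y ∈ U → Disjoint U N →
    ∀ M : V → V → R, (∀ v, M x v = 0) → (∀ v, M v y = 0) → (∀ v ∈ N, ∀ u, M v u = 0) →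
      (∀ v ∈ N, ∀ u, M u v = 0) →
      mapSum P (U ∪ N) (fun u v => M u v + Γ u v) =
        mapSum P U (fun u v => M u v + arrowWeight i j r u v + arrowWeight x y 1 u v)

/-- All the arrows of `Γ` touch `N`, and are compatible with the endpoints `i`, `j`, `x`, `y`. -/
def GadgetSupport {V R : Type} [Zero R] (i j x y : V) (N : Finset V) (Γ : V → V → R) : Prop :=
  ∀ a b, Γ a b ≠ 0 → (a ∈ N ∧ (b ∈ N ∨ b = j ∨ b = y)) ∨ ((a = i ∨ a = x) ∧ b ∈ N)

theorem mapSum_mulGadget {V R : Type} [Fintype V] [DecidableEq V] [CommRing R]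
    {P : Finset V → (V → V) → Prop} (hP : IsInsertable P) {U : Finset V}
    {i j x y w c d : V} (hw : w ∉ U) (hc : c ∉ U) (hd : d ∉ U) (hwc : w ≠ c) (hwd : w ≠ d)
    (hcd : c ≠ d) (hi : i ∈ U) (hj : j ∈ U) (hx : x ∈ U) (hy : y ∈ U) (hix : i ≠ x) (hjy : j ≠ y)
    (f g : R) (M : V → V → R) (hMx : ∀ v, M x v = 0) (hMy : ∀ v, M v y = 0)
    (hMr : ∀ v, v = w ∨ v = c ∨ v = d → ∀ u, M v u = 0)
    (hMc : ∀ v, v = w ∨ v = c ∨ v = d → ∀ u, M u v = 0) :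
    mapSum P (insert c (insert d (insert w U)))
      (fun u v => M u v + arrowWeight x c 1 u v + arrowWeight c d 1 u v + arrowWeight c w 1 u v +
        arrowWeight w d 1 u v + arrowWeight d y 1 u v + arrowWeight i w f u v +
        arrowWeight w j g u v) =
    mapSum P U (fun u v => M u v + arrowWeight i j (f * g) u v + arrowWeight x y 1 u v) := by
  have hne : ∀ {a b : V}, a ∈ U → b ∉ U → a ≠ b := fun ha hb h => hb (h ▸ ha)
  have n1 := hne hi hw
  have n2 := hne hi hc
  have n3 := hne hi hd
  have n4 := hne hj hw
  have n5 := hne hj hc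
  have n6 := hne hj hd
  have n7 := hne hx hw
  have n8 := hne hx hc
  have n9 := hne hx hd
  have m1 := hne hy hw
  have m2 := hne hy hc
  have m3 := hne hy hd
  have r1 := hMr w (by simp)
  have r2 := hMr c (by simp)
  have r3 := hMr d (by simp)
  have s1 := hMc w (by simp)
  have s2 := hMc c (by simp)
  have s3 := hMc d (by simp)
  rw [mapSum_rowSplit (x := x) hP (M := fun u v => M u v + arrowWeight x d 1 u v +
      arrowWeight x w 1 u v + arrowWeight w d 1 u v + arrowWeight d y 1 u v +
      arrowWeight i w f u v + arrowWeight w j g u v),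
    mapSum_colSplit (y := y) hP (M := fun u v => M u v + arrowWeight x y 1 u v +
      arrowWeight x w 1 u v + arrowWeight w y 1 u v +
      arrowWeight i w f u v + arrowWeight w j g u v),
    mapSum_path (i := i) (j := j) (x := x) (y := y) (f := f) (g := g) hP hw hi hx hy hix hjy
      (N := fun u v => M u v + arrowWeight x y 1 u v)]
  · congr 1
    funext u v
    simp only [arrowWeight]
    ring
  · intro v hv
    simp [arrowWeight, hMx]
  · intro v hv hvx
    simp [arrowWeight, hMy, hvx]
  · simp [arrowWeight, r1, n1.symm, n4.symm, n7.symm, m1.symm]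
  · intro u hu v hv
    have := hne hu hw
    have := hne hv hw
    simp [arrowWeight, *]
  · intro u hu
    have := hne hu hw
    simp [arrowWeight, m1.symm, n4.symm, s1, this]
  · intro v hv
    have := hne hv hw
    simp [arrowWeight, r1, n1.symm, n7.symm]
  · simp [hd, hwd.symm]
  · simp [hy]
  · intro v hv
    simp [arrowWeight, r3, n9.symm, hwd.symm, n3.symm]
  · intro v hv
    have : v ≠ d := by
      rintro rfl
      simp [hd, hwd.symm] at hv
    simp [arrowWeight, s3, hMy, hwd.symm, n6.symm, this, m3.symm, m1, hjy.symm]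
  · intro u hu v hv hvy
    have h1 : u ≠ d := by
      rintro rfl
      simp [hd, hwd.symm] at hu
    have h2 : v ≠ d := by
      rintro rfl
      simp [hd, hwd.symm] at hv
    simp [arrowWeight, h1, h2, hvy]
  · simp [hc, hwc.symm, hcd]
  · simp [hx]
  · intro v hv
    simp [arrowWeight, s2, hwc.symm, n5.symm, m2.symm, hcd]
  · intro v hv
    have : v ≠ c := by
      rintro rfl
      simp [hc, hwc.symm, hcd] at hv
    simp [arrowWeight, r2, hMx, hwc.symm, hcd, n2.symm, this, n7, n9, hix.symm]
  · intro u hu hux v hv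
    have h1 : u ≠ c := by
      rintro rfl
      simp [hc, hwc.symm, hcd] at hu
    have h2 : v ≠ c := by
      rintro rfl
      simp [hc, hwc.symm, hcd] at hv
    simp [arrowWeight, h1, h2, hux]

theorem GadgetSupport.row_eq_zero {V R : Type} [Zero R] {i j x y : V} {N : Finset V}
    {Γ : V → V → R} (h : GadgetSupport i j x y N Γ) {a : V} (ha : a ∉ N) (hi : a ≠ i)
    (hx : a ≠ x) (b : V) : Γ a b = 0 := by
  by_contra h0
  have := h a b h0
  tauto

theorem GadgetSupport.col_eq_zero {V R : Type} [Zero R] {i j x y : V} {N : Finset V}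
    {Γ : V → V → R} (h : GadgetSupport i j x y N Γ) {b : V} (hb : b ∉ N) (hj : b ≠ j)
    (hy : b ≠ y) (a : V) : Γ a b = 0 := by
  by_contra h0
  have := h a b h0
  tauto

theorem isGadget_leaf {V R : Type} [Fintype V] [DecidableEq V] [CommRing R]
    {P : Finset V → (V → V) → Prop} (hP : IsInsertable P) {i j x y w c d : V}
    (hwc : w ≠ c) (hwd : w ≠ d) (hcd : c ≠ d) (hix : i ≠ x) (hjy : j ≠ y) (r : R) :
    IsGadget P i j x y {w, c, d} r (fun u v => arrowWeight x c 1 u v + arrowWeight c d 1 u v +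
      arrowWeight c w 1 u v + arrowWeight w d 1 u v + arrowWeight d y 1 u v +
      arrowWeight i w r u v + arrowWeight w j 1 u v) := by
  intro U hi hj hx hy hU M hMx hMy hr hs
  simp only [Finset.disjoint_insert_right, Finset.disjoint_singleton_right] at hU
  have h1 : U ∪ {w, c, d} = insert c (insert d (insert w U)) := by
    ext v
    simp only [Finset.mem_union, Finset.mem_insert, Finset.mem_singleton]
    tauto
  have := mapSum_mulGadget hP hU.1 hU.2.1 hU.2.2 hwc hwd hcd hi hj hx hy hix hjy r 1 M hMx hMy
    (fun v hv => hr v (by simpa using hv)) (fun v hv => hs v (by simpa using hv))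
  rw [mul_one] at this
  rw [h1, ← this]
  congr 1
  funext u v
  ring

theorem IsGadget.add {V R : Type} [Fintype V] [DecidableEq V] [CommRing R]
    {P : Finset V → (V → V) → Prop} (hP : IsInsertable P) {i j x y c : V} {N₁ N₂ : Finset V}
    {f g : R} {Γ₁ Γ₂ : V → V → R} (hix : i ≠ x) (hjy : j ≠ y)
    (hc : c ∉ N₁) (hc' : c ∉ N₂) (hN : Disjoint N₁ N₂)
    (h₁ : IsGadget P i j x c N₁ f Γ₁) (h₂ : IsGadget P i j c y N₂ g Γ₂)
    (s₁ : GadgetSupport i j x c N₁ Γ₁) :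
    IsGadget P i j x y (insert c (N₁ ∪ N₂)) (f + g) (fun u v => Γ₁ u v + Γ₂ u v) := by
  intro U hi hj hx hy hU M hMx hMy hr hs
  simp only [Finset.disjoint_insert_right, Finset.disjoint_union_right] at hU
  obtain ⟨hcU, hU1, hU2⟩ := hU
  have hne : ∀ {a b : V}, a ∈ U → b ∉ U → a ≠ b := fun ha hb h => hb (h ▸ ha)
  have n1 := hne hi hcU
  have n2 := hne hj hcU
  have n3 := hne hx hcU
  have n4 := hne hy hcU
  have e1 : ∀ v ∈ U, v ∉ N₁ := fun v hv h => Finset.disjoint_left.1 hU1 hv h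
  have e2 : ∀ v ∈ U, v ∉ N₂ := fun v hv h => Finset.disjoint_left.1 hU2 hv h
  have e3 : ∀ v ∈ N₂, v ∉ N₁ := fun v hv h => Finset.disjoint_left.1 hN h hv
  have hset : U ∪ insert c (N₁ ∪ N₂) = (insert c U ∪ N₁) ∪ N₂ := by
    ext v
    simp only [Finset.mem_union, Finset.mem_insert]
    tauto
  have step2 := h₂ (insert c U ∪ N₁) (by simp [hi]) (by simp [hj]) (by simp) (by simp [hy])
    (by simp [Finset.disjoint_union_left, hU2, hc', hN]) (fun u v => M u v + Γ₁ u v)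
    (fun v => by rw [hr c (by simp), s₁.row_eq_zero hc n1.symm n3.symm, add_zero])
    (fun v => by rw [hMy, s₁.col_eq_zero (e1 y hy) hjy.symm n4, add_zero])
    (fun v hv u => by
      rw [hr v (by simp [hv]), s₁.row_eq_zero (e3 v hv) (fun h => e2 i hi (h ▸ hv))
        (fun h => e2 x hx (h ▸ hv)), add_zero])
    (fun v hv u => by
      rw [hs v (by simp [hv]), s₁.col_eq_zero (e3 v hv) (fun h => e2 j hj (h ▸ hv))
        (fun h => hc' (h ▸ hv)), add_zero])
  have step1 := h₁ (insert c U) (by simp [hi]) (by simp [hj]) (by simp [hx]) (by simp)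
    (by simp [Finset.disjoint_insert_left, hU1, hc])
    (fun u v => M u v + arrowWeight i j g u v + arrowWeight c y 1 u v)
    (fun v => by simp [hMx, arrowWeight, hix.symm, n3])
    (fun v => by simp [hs c, arrowWeight, n2.symm, n4.symm])
    (fun v hv u => by
      have a1 : v ≠ i := fun h => e1 i hi (h ▸ hv)
      have a2 : v ≠ c := fun h => hc (h ▸ hv)
      simp [hr v (by simp [hv]), arrowWeight, a1, a2])
    (fun v hv u => by
      have a1 : v ≠ j := fun h => e1 j hj (h ▸ hv)
      have a2 : v ≠ y := fun h => e1 y hy (h ▸ hv)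
      simp [hs v (by simp [hv]), arrowWeight, a1, a2])
  rw [hset]
  calc _ = _ := by
        refine Eq.trans ?_ step2
        congr 1
        funext u v
        ring
    _ = _ := by
        refine Eq.trans ?_ step1
        congr 1
        funext u v
        ring
    _ = _ := by
        have z1 := hr c (by simp)
        have z2 := hs c (by simp)
        apply mapSum_rowSplit (x := x) hP hcU hx
        · intro v hv
          simp [arrowWeight, z2, n2.symm, n4.symm]
        · intro v hv
          simp [arrowWeight, z1, n1.symm, n3.symm, hMx, hix.symm]
        · intro u hu hux v hv
          have := hne hu hcU
          by_cases hui : u = i ∧ v = j <;> simp [arrowWeight, hui, hux, this]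
          · simp only [n1, hix, false_and, if_false]
            ring

theorem IsGadget.mul {V R : Type} [Fintype V] [DecidableEq V] [CommRing R]
    {P : Finset V → (V → V) → Prop} (hP : IsInsertable P) {i j x y w c d : V} {N₁ N₂ : Finset V}
    {f g : R} {Γ₁ Γ₂ : V → V → R} (hix : i ≠ x) (hjy : j ≠ y)
    (hwc : w ≠ c) (hwd : w ≠ d) (hcd : c ≠ d)
    (h0 : Disjoint {w, c, d} (N₁ ∪ N₂)) (hN : Disjoint N₁ N₂)
    (h₁ : IsGadget P i w x c N₁ f Γ₁) (h₂ : IsGadget P w j d y N₂ g Γ₂)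
    (s₁ : GadgetSupport i w x c N₁ Γ₁) :
    IsGadget P i j x y ({w, c, d} ∪ (N₁ ∪ N₂)) (f * g) (fun u v => arrowWeight c d 1 u v +
      arrowWeight c w 1 u v + arrowWeight w d 1 u v + Γ₁ u v + Γ₂ u v) := by
  intro U hi hj hx hy hU M hMx hMy hr hs
  simp only [Finset.disjoint_insert_right, Finset.disjoint_union_right,
    Finset.disjoint_singleton_right, Finset.disjoint_insert_left,
    Finset.disjoint_singleton_left] at hU h0
  obtain ⟨⟨hwU, hcU, hdU⟩, hU1, hU2⟩ := hU
  obtain ⟨⟨hw1, hc1, hd1⟩, hw2, hc2, hd2⟩ := h0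
  have hne : ∀ {a b : V}, a ∈ U → b ∉ U → a ≠ b := fun ha hb h => hb (h ▸ ha)
  have e1 : ∀ v ∈ U, v ∉ N₁ := fun v hv h => Finset.disjoint_left.1 hU1 hv h
  have e2 : ∀ v ∈ U, v ∉ N₂ := fun v hv h => Finset.disjoint_left.1 hU2 hv h
  have e3 : ∀ v ∈ N₂, v ∉ N₁ := fun v hv h => Finset.disjoint_left.1 hN h hv
  have hset : U ∪ ({w, c, d} ∪ (N₁ ∪ N₂)) = (insert c (insert d (insert w U)) ∪ N₁) ∪ N₂ := by
    ext v
    simp only [Finset.mem_union, Finset.mem_insert, Finset.mem_singleton]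
    tauto
  have step2 := h₂ (insert c (insert d (insert w U)) ∪ N₁) (by simp) (by simp [hj]) (by simp)
    (by simp [hy])
    (by simp [Finset.disjoint_union_left, Finset.disjoint_insert_left, hU2, hw2, hc2, hd2, hN])
    (fun u v => M u v + arrowWeight c d 1 u v + arrowWeight c w 1 u v +
      arrowWeight w d 1 u v + Γ₁ u v)
    (fun v => by
      rw [hr d (by simp), s₁.row_eq_zero hd1 (hne hi hdU).symm (hne hx hdU).symm]
      simp [arrowWeight, hcd.symm, hwd.symm])
    (fun v => by
      rw [hMy, s₁.col_eq_zero (e1 y hy) (hne hy hwU) (hne hy hcU)]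
      simp [arrowWeight, hne hy hwU, hne hy hdU])
    (fun v hv u => by
      have a1 : v ≠ c := fun h => hc2 (h ▸ hv)
      have a2 : v ≠ w := fun h => hw2 (h ▸ hv)
      rw [hr v (by simp [hv]), s₁.row_eq_zero (e3 v hv) (fun h => e2 i hi (h ▸ hv))
        (fun h => e2 x hx (h ▸ hv))]
      simp [arrowWeight, a1, a2])
    (fun v hv u => by
      have a1 : v ≠ w := fun h => hw2 (h ▸ hv)
      have a2 : v ≠ d := fun h => hd2 (h ▸ hv)
      rw [hs v (by simp [hv]), s₁.col_eq_zero (e3 v hv) a1 (fun h => hc2 (h ▸ hv))]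
      simp [arrowWeight, a1, a2])
  have step1 := h₁ (insert c (insert d (insert w U))) (by simp [hi]) (by simp) (by simp [hx])
    (by simp) (by simp [Finset.disjoint_insert_left, hU1, hw1, hc1, hd1])
    (fun u v => M u v + arrowWeight c d 1 u v + arrowWeight c w 1 u v +
      arrowWeight w d 1 u v + arrowWeight w j g u v + arrowWeight d y 1 u v)
    (fun v => by simp [hMx, arrowWeight, hne hx hwU, hne hx hcU, hne hx hdU])
    (fun v => by
      simp [hs c, arrowWeight, hwc.symm, hcd, (hne hj hcU).symm, (hne hy hcU).symm])
    (fun v hv u => by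
      have a1 : v ≠ c := fun h => hc1 (h ▸ hv)
      have a2 : v ≠ w := fun h => hw1 (h ▸ hv)
      have a3 : v ≠ d := fun h => hd1 (h ▸ hv)
      simp [hr v (by simp [hv]), arrowWeight, a1, a2, a3])
    (fun v hv u => by
      have a1 : v ≠ w := fun h => hw1 (h ▸ hv)
      have a2 : v ≠ d := fun h => hd1 (h ▸ hv)
      have a3 : v ≠ j := fun h => e1 j hj (h ▸ hv)
      have a4 : v ≠ y := fun h => e1 y hy (h ▸ hv)
      simp [hs v (by simp [hv]), arrowWeight, a1, a2, a3, a4])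
  have step0 := mapSum_mulGadget hP hwU hcU hdU hwc hwd hcd hi hj hx hy hix hjy f g M hMx hMy
    (fun v hv => hr v (by simp only [Finset.mem_union, Finset.mem_insert,
      Finset.mem_singleton]; tauto))
    (fun v hv => hs v (by simp only [Finset.mem_union, Finset.mem_insert,
      Finset.mem_singleton]; tauto))
  rw [hset, ← step0]
  calc _ = _ := by
        refine Eq.trans ?_ step2
        congr 1
        funext u v
        ring
    _ = _ := by
        refine Eq.trans ?_ step1
        congr 1
        funext u v
        ring
    _ = _ := by
        congr 1
        funext u v
        ring

/-! ### Building tree decompositions bag by bag -/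

/-- `BagFamily k U 𝔅`: there is a tree decomposition of `U` with set of bags `𝔅`, of width at
most `k`, built by attaching leaves. -/
inductive BagFamily {V : Type} [DecidableEq V] (k : ℕ) : Finset V → Finset (Finset V) → Prop
  | single (Y : Finset V) : Y.card ≤ k + 1 → BagFamily k Y {Y}
  | attach (U : Finset V) (𝔅 : Finset (Finset V)) (Z Y : Finset V) : BagFamily k U 𝔅 → Z ∈ 𝔅 →
      Y.card ≤ k + 1 → (∀ v ∈ Y, v ∈ U → v ∈ Z) → BagFamily k (U ∪ Y) (insert Y 𝔅)

/-- A bag family comes from an array of bags with a parent function. -/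
theorem BagFamily.exists_parent {V : Type} [DecidableEq V] {k : ℕ} {U : Finset V}
    {𝔅 : Finset (Finset V)} (h : BagFamily k U 𝔅) :
    ∃ (n : ℕ) (X : ℕ → Finset V) (p : ℕ → ℕ), 0 < n ∧ (∀ t, 0 < t → t < n → p t < t) ∧
      (∀ t < n, (X t).card ≤ k + 1) ∧ (∀ t < n, X t ⊆ U) ∧ (∀ Y ∈ 𝔅, ∃ t < n, X t = Y) ∧
      ∀ v ∈ U, ∃ r < n, v ∈ X r ∧ ∀ t < n, v ∈ X t → t ≠ r → 0 < t ∧ v ∈ X (p t) := by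
  induction h with
  | single Y hY =>
    refine ⟨1, fun _ => Y, fun _ => 0, one_pos, fun t h1 h2 => by omega, fun _ _ => hY,
      fun _ _ => subset_rfl, fun Z hZ => ⟨0, one_pos, (Finset.mem_singleton.1 hZ).symm⟩, ?_⟩
    intro v hv
    exact ⟨0, one_pos, hv, fun t ht _ h => absurd (by omega) h⟩
  | attach U 𝔅 Z Y _ hZ hY hYU ih =>
    obtain ⟨n, X, p, hn, hp, hX, hXU, hall, hv⟩ := ih
    obtain ⟨z, hz, hzZ⟩ := hall Z hZ
    have hX' : ∀ t < n, Function.update X n Y t = X t := fun t ht =>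
      Function.update_of_ne (by omega) _ _
    have hp' : ∀ t < n, Function.update p n z t = p t := fun t ht =>
      Function.update_of_ne (by omega) _ _
    refine ⟨n + 1, Function.update X n Y, Function.update p n z, by omega, ?_, ?_, ?_, ?_, ?_⟩
    · intro t h1 h2
      rcases Nat.lt_succ_iff_lt_or_eq.1 h2 with h | rfl
      · rw [hp' t h]
        exact hp t h1 h
      · simpa using hz
    · intro t h2
      rcases Nat.lt_succ_iff_lt_or_eq.1 h2 with h | rfl
      · rw [hX' t h]
        exact hX t h
      · simpa using hY
    · intro t h2
      rcases Nat.lt_succ_iff_lt_or_eq.1 h2 with h | rfl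
      · rw [hX' t h]
        exact (hXU t h).trans Finset.subset_union_left
      · simp
    · intro W hW
      rcases Finset.mem_insert.1 hW with rfl | hW
      · exact ⟨n, by omega, by simp⟩
      · obtain ⟨t, ht, h⟩ := hall W hW
        exact ⟨t, by omega, by rw [hX' t ht, h]⟩
    · intro v hvU
      by_cases hvU' : v ∈ U
      · obtain ⟨r, hr, hvr, h⟩ := hv v hvU'
        refine ⟨r, by omega, by rwa [hX' r hr], ?_⟩
        intro t h2 hvt htr
        rcases Nat.lt_succ_iff_lt_or_eq.1 h2 with ht | rfl
        · rw [hX' t ht] at hvt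
          obtain ⟨h0, hpt⟩ := h t ht hvt htr
          rw [hp' t ht, hX' _ ((hp t h0 ht).trans ht)]
          exact ⟨h0, hpt⟩
        · refine ⟨by omega, ?_⟩
          rw [Function.update_self] at hvt ⊢
          rw [hX' z hz, hzZ]
          exact hYU v hvt hvU'
      · have hvY : v ∈ Y := by simpa [hvU'] using hvU
        refine ⟨n, by omega, by simpa using hvY, ?_⟩
        intro t h2 hvt htr
        have ht : t < n := by omega
        rw [hX' t ht] at hvt
        exact absurd (hXU t ht hvt) hvU'

/-- The tree on `Fin n` with parent function `p`. -/
def parentTree (n : ℕ) (p : ℕ → ℕ) : SimpleGraph (Fin n) :=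
  SimpleGraph.fromRel fun a b => 0 < a.1 ∧ b.1 = p a.1

theorem parentTree_adj_parent {n : ℕ} {p : ℕ → ℕ} (hp : ∀ t, 0 < t → t < n → p t < t)
    (t : Fin n) (ht : 0 < t.1) :
    (parentTree n p).Adj t ⟨p t.1, (hp t.1 ht t.2).trans t.2⟩ := by
  rw [parentTree, SimpleGraph.fromRel_adj]
  refine ⟨fun h => ?_, Or.inl ⟨ht, rfl⟩⟩
  have := congrArg Fin.val h
  have := hp t.1 ht t.2
  simp at *
  omega

theorem parentTree_isTree {n : ℕ} {p : ℕ → ℕ} (hn : 0 < n)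
    (hp : ∀ t, 0 < t → t < n → p t < t) : (parentTree n p).IsTree := by
  have hreach : ∀ a : ℕ, ∀ ha : a < n, (parentTree n p).Reachable ⟨a, ha⟩ ⟨0, hn⟩ := by
    intro a
    induction a using Nat.strong_induction_on with
    | _ a ih =>
      intro ha
      rcases Nat.eq_zero_or_pos a with rfl | h0
      · rfl
      · exact (parentTree_adj_parent hp ⟨a, ha⟩ h0).reachable.trans (ih _ (hp a h0 ha) _)
  have hconn : (parentTree n p).Connected :=
    { preconnected := fun a b => (hreach a.1 a.2).trans (hreach b.1 b.2).symm
      nonempty := ⟨⟨0, hn⟩⟩ }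
  have hle : (parentTree n p).edgeFinset.card ≤ n - 1 := by
    have : (parentTree n p).edgeFinset ⊆
        (Finset.univ.erase (⟨0, hn⟩ : Fin n)).image
          (fun t => s(t, ⟨p t.1 % n, Nat.mod_lt _ hn⟩)) := by
      intro e he
      induction e using Sym2.ind with
      | _ a b =>
        rw [SimpleGraph.mem_edgeFinset, SimpleGraph.mem_edgeSet, parentTree,
          SimpleGraph.fromRel_adj] at he
        rw [Finset.mem_image]
        rcases he.2 with ⟨h0, hb⟩ | ⟨h0, hb⟩
        · refine ⟨a, ?_, ?_⟩
          · simp [Fin.ext_iff]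
            omega
          · congr 2
            simp [← hb, Nat.mod_eq_of_lt b.2]
        · refine ⟨b, ?_, ?_⟩
          · simp [Fin.ext_iff]
            omega
          · rw [Sym2.eq_swap]
            congr 2
            simp [← hb, Nat.mod_eq_of_lt a.2]
    refine (Finset.card_le_card this).trans (Finset.card_image_le.trans ?_)
    simp
  rw [SimpleGraph.isTree_iff_connected_and_card]
  refine ⟨hconn, ?_⟩
  have h1 := hconn.card_vert_le_card_edgeSet_add_one
  rw [SimpleGraph.edgeFinset_card, ← Nat.card_eq_fintype_card] at hle
  rw [Nat.card_eq_fintype_card, Fintype.card_fin] at h1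
  rw [Nat.card_eq_fintype_card (α := Fin n), Fintype.card_fin]
  omega

/-- The set of nodes `t` of `parentTree` with property `S` is connected, provided that all of them
but one have their parent in `S`. -/
theorem parentTree_induce_connected {n : ℕ} {p : ℕ → ℕ}
    (hp : ∀ t, 0 < t → t < n → p t < t) {S : ℕ → Prop} {r : ℕ} (hr : r < n) (hrS : S r)
    (h : ∀ t < n, S t → t ≠ r → 0 < t ∧ S (p t)) :
    ((parentTree n p).induce {t : Fin n | S t.1}).Connected := by
  have hreach : ∀ a : ℕ, ∀ ha : a < n, ∀ hS : S a,
      ((parentTree n p).induce {t : Fin n | S t.1}).Reachable ⟨⟨a, ha⟩, hS⟩ ⟨⟨r, hr⟩, hrS⟩ := by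
    intro a
    induction a using Nat.strong_induction_on with
    | _ a ih =>
      intro ha hS
      by_cases har : a = r
      · subst har
        rfl
      · obtain ⟨h0, hSp⟩ := h a ha hS har
        have hlt := hp a h0 ha
        refine SimpleGraph.Reachable.trans (SimpleGraph.Adj.reachable ?_)
          (ih (p a) hlt (hlt.trans ha) hSp)
        rw [SimpleGraph.induce_adj]
        exact parentTree_adj_parent hp ⟨a, ha⟩ h0
  exact
    { preconnected := fun a b => (hreach a.1.1 a.1.2 a.2).trans (hreach b.1.1 b.1.2 b.2).symm
      nonempty := ⟨⟨⟨r, hr⟩, hrS⟩⟩ }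

theorem BagFamily.hasTreewidthAtMost {V : Type} [Fintype V] [DecidableEq V] {k : ℕ}
    {𝔅 : Finset (Finset V)} (h : BagFamily k (Finset.univ : Finset V) 𝔅) (G : SimpleGraph V)
    (hG : ∀ u v, G.Adj u v → ∃ Y ∈ 𝔅, u ∈ Y ∧ v ∈ Y) : HasTreewidthAtMost G k := by
  obtain ⟨n, X, p, hn, hp, hX, -, hall, hv⟩ := h.exists_parent
  refine ⟨n, parentTree n p, fun t => X t.1, parentTree_isTree hn hp, fun t => hX t.1 t.2, ?_, ?_,
    ?_⟩
  · intro v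
    obtain ⟨r, hr, hvr, -⟩ := hv v (Finset.mem_univ v)
    exact ⟨⟨r, hr⟩, hvr⟩
  · intro u v huv
    obtain ⟨Y, hY, hu, hv'⟩ := hG u v huv
    obtain ⟨t, ht, rfl⟩ := hall Y hY
    exact ⟨⟨t, ht⟩, hu, hv'⟩
  · intro v
    obtain ⟨r, hr, hvr, h⟩ := hv v (Finset.mem_univ v)
    exact parentTree_induce_connected hp hr hvr h

/-- A polynomial that is a constant or a variable. -/
def IsEntry {ν K : Type} [CommRing K] (p : MvPolynomial ν K) : Prop :=
  (∃ a : K, p = MvPolynomial.C a) ∨ ∃ v, p = MvPolynomial.X v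

theorem isEntry_zero {ν K : Type} [CommRing K] : IsEntry (0 : MvPolynomial ν K) :=
  Or.inl ⟨0, by simp⟩

theorem isEntry_one {ν K : Type} [CommRing K] : IsEntry (1 : MvPolynomial ν K) :=
  Or.inl ⟨1, by simp⟩

theorem isEntry_arrowWeight {ν K V : Type} [CommRing K] [DecidableEq V] {a b : V}
    {r : MvPolynomial ν K} (hr : IsEntry r) (u v : V) : IsEntry (arrowWeight a b r u v) := by
  rw [arrowWeight]
  split_ifs
  · exact hr
  · exact isEntry_zero

theorem IsEntry.add {ν K : Type} [CommRing K] {p q : MvPolynomial ν K} (hp : IsEntry p)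
    (hq : IsEntry q) (h : p ≠ 0 → q = 0) : IsEntry (p + q) := by
  by_cases h0 : p = 0
  · rwa [h0, zero_add]
  · rwa [h h0, add_zero]

theorem IsEntry.add_arrowWeight {ν K V : Type} [CommRing K] [DecidableEq V] {a b u v : V}
    {p r : MvPolynomial ν K} (hp : IsEntry p) (hr : IsEntry r) (h : u = a → v = b → p = 0) :
    IsEntry (p + arrowWeight a b r u v) := by
  refine hp.add (isEntry_arrowWeight hr u v) fun h0 => ?_
  rw [arrowWeight, if_neg]
  exact fun huv => h0 (h huv.1 huv.2)

/-- Tree decompositions can be extended to contain the arrows of the gadget `Γ`. -/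
def GadgetCovered {V R : Type} [DecidableEq V] [Zero R] (k : ℕ) (i j x y : V) (N : Finset V)
    (Γ : V → V → R) : Prop :=
  ∀ (U : Finset V) (𝔅 : Finset (Finset V)) (Z : Finset V), BagFamily k U 𝔅 → Z ∈ 𝔅 → i ∈ Z →
    j ∈ Z → x ∈ Z → y ∈ Z → Disjoint U N → ∃ 𝔅', 𝔅 ⊆ 𝔅' ∧ BagFamily k (U ∪ N) 𝔅' ∧
      ∀ a b, Γ a b ≠ 0 → ∃ Y ∈ 𝔅', a ∈ Y ∧ b ∈ Y

namespace Formula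

/-- The number of vertices added when simulating a formula. -/
def cost {K ν : Type} : Formula K ν → ℕ
  | const _ => 3
  | var _ => 3
  | add f g => 1 + (f.cost + g.cost)
  | mul f g => 3 + (f.cost + g.cost)

theorem cost_le {K ν : Type} (φ : Formula K ν) : φ.cost ≤ 3 * φ.size := by
  induction φ with
  | const _ => simp [cost, size]
  | var _ => simp [cost, size]
  | add f g hf hg => simp only [cost, size]; omega
  | mul f g hf hg => simp only [cost, size]; omega

end Formula

theorem BagFamily.subset {V : Type} [DecidableEq V] {k : ℕ} {U : Finset V}
    {𝔅 : Finset (Finset V)} (h : BagFamily k U 𝔅) : ∀ Z ∈ 𝔅, Z ⊆ U := by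
  obtain ⟨n, X, p, -, -, -, hX, hall, -⟩ := h.exists_parent
  intro Z hZ
  obtain ⟨t, ht, rfl⟩ := hall Z hZ
  exact hX t ht

theorem BagFamily.extend {V : Type} [DecidableEq V] {k : ℕ} {U W Y Z : Finset V}
    {𝔅 : Finset (Finset V)} (h : BagFamily k U 𝔅) (hZ : Z ∈ 𝔅) (hY : Y.card ≤ k + 1)
    (hYZ : ∀ v ∈ Y, v ∈ Z ∨ v ∈ W) (hW : W ⊆ Y) (hU : Disjoint U W) :
    BagFamily k (U ∪ W) (insert Y 𝔅) := by
  have hset : U ∪ W = U ∪ Y := by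
    ext v
    have h1 := hYZ v
    have h2 := @hW v
    have h3 : v ∈ Z → v ∈ U := fun hv => h.subset Z hZ hv
    simp only [Finset.mem_union]
    tauto
  rw [hset]
  refine BagFamily.attach U 𝔅 Z Y h hZ hY fun v hv hvU => ?_
  exact (hYZ v hv).resolve_right (Finset.disjoint_left.1 hU hvU)

theorem card_insert_seven_le {V : Type} [DecidableEq V] (a b c d e f g : V) :
    ({a, b, c, d, e, f, g} : Finset V).card ≤ 6 + 1 :=
  (Finset.card_insert_le _ _).trans (Nat.succ_le_succ Finset.card_le_six)

theorem BagFamily.extend_seven {V : Type} [DecidableEq V] {U Z : Finset V}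
    {𝔅 : Finset (Finset V)} (h : BagFamily 6 U 𝔅) (hZ : Z ∈ 𝔅) {i j x y w c d : V} (hi : i ∈ Z)
    (hj : j ∈ Z) (hx : x ∈ Z) (hy : y ∈ Z) (hU : Disjoint U {w, c, d}) :
    BagFamily 6 (U ∪ {w, c, d}) (insert {i, j, x, y, w, c, d} 𝔅) := by
  refine h.extend hZ (card_insert_seven_le _ _ _ _ _ _ _) ?_ ?_ hU
  · intro v hv
    rw [Finset.mem_insert, Finset.mem_insert, Finset.mem_insert, Finset.mem_insert] at hv
    rcases hv with rfl | rfl | rfl | rfl | hv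
    · exact Or.inl hi
    · exact Or.inl hj
    · exact Or.inl hx
    · exact Or.inl hy
    · exact Or.inr hv
  · intro v hv
    rw [Finset.mem_insert, Finset.mem_insert, Finset.mem_singleton] at hv
    rcases hv with rfl | rfl | rfl <;> simp

theorem exists_gadget_leaf {K ν V : Type} [CommRing K] [Fintype V] [DecidableEq V]
    {P : Finset V → (V → V) → Prop} (hP : IsInsertable P) {r : MvPolynomial ν K} (hr : IsEntry r)
    {i j x y : V} {N : Finset V} (hi : i ∉ N) (hj : j ∉ N) (hx : x ∉ N) (hy : y ∉ N)
    (hix : i ≠ x) (hjy : j ≠ y) (hN : N.card = 3) :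
    ∃ Γ : V → V → MvPolynomial ν K, (∀ a b, IsEntry (Γ a b)) ∧ GadgetSupport i j x y N Γ ∧
      IsGadget P i j x y N r Γ ∧ GadgetCovered 6 i j x y N Γ := by
  obtain ⟨w, c, d, hwc, hwd, hcd, rfl⟩ := Finset.card_eq_three.1 hN
  simp only [Finset.mem_insert, Finset.mem_singleton, not_or] at hi hj hx hy
  have hΓ : ∀ a b, arrowWeight x c 1 a b + arrowWeight c d 1 a b +
      arrowWeight c w 1 a b + arrowWeight w d 1 a b + arrowWeight d y 1 a b +
      arrowWeight i w r a b + arrowWeight w j 1 a b ≠ 0 →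
      (a = x ∧ b = c) ∨ (a = c ∧ b = d) ∨ (a = c ∧ b = w) ∨ (a = w ∧ b = d) ∨ (a = d ∧ b = y) ∨
      (a = i ∧ b = w) ∨ (a = w ∧ b = j) := by
    intro a b h
    by_contra hcon
    simp only [not_or] at hcon
    obtain ⟨h1, h2, h3, h4, h5, h6, h7⟩ := hcon
    exact h (by simp [arrowWeight, h1, h2, h3, h4, h5, h6, h7])
  refine ⟨_, ?_, ?_, isGadget_leaf hP hwc hwd hcd hix hjy r, ?_⟩
  · intro a b
    have h1 := isEntry_one (ν := ν) (K := K)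
    refine ((((((isEntry_arrowWeight h1 a b).add_arrowWeight h1 ?_).add_arrowWeight h1
      ?_).add_arrowWeight h1 ?_).add_arrowWeight h1 ?_).add_arrowWeight hr ?_).add_arrowWeight h1
      ?_ <;> rintro rfl rfl <;>
      simp [arrowWeight, hwc, hwd, hix, hjy, hwd.symm, hcd.symm, hi, hj, hy]
  · intro a b h
    have := hΓ a b h
    simp only [Finset.mem_insert, Finset.mem_singleton]
    tauto
  · intro U 𝔅 Z hU hZ hiZ hjZ hxZ hyZ hdis
    refine ⟨insert {i, j, x, y, w, c, d} 𝔅, Finset.subset_insert _ _,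
      hU.extend_seven hZ hiZ hjZ hxZ hyZ hdis, ?_⟩
    · intro a b h
      refine ⟨_, Finset.mem_insert_self _ _, ?_⟩
      rcases hΓ a b h with h | h | h | h | h | h | h <;> simp [h.1, h.2]

theorem GadgetSupport.eq_zero_of_ne_zero {V R : Type} [Zero R] {i j x y i' j' x' y' : V}
    {N N' : Finset V} {Γ Γ' : V → V → R} (h : GadgetSupport i j x y N Γ)
    (h' : GadgetSupport i' j' x' y' N' Γ') (hN : Disjoint N N')
    (hi : i ∉ N') (hj : j ∉ N') (hx : x ∉ N') (hy : y ∉ N') {a b : V} (h0 : Γ a b ≠ 0) :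
    Γ' a b = 0 := by
  have e1 : ∀ v, v ∈ N → v ∉ N' := fun v hv => Finset.disjoint_left.1 hN hv
  by_contra h1
  rcases h' a b h1 with ⟨ha, -⟩ | ⟨-, hb⟩
  · rcases h a b h0 with ⟨ha', -⟩ | ⟨rfl | rfl, -⟩
    · exact e1 a ha' ha
    · exact hi ha
    · exact hx ha
  · rcases h a b h0 with ⟨-, hb' | rfl | rfl⟩ | ⟨-, hb'⟩
    · exact e1 b hb' hb
    · exact hj hb
    · exact hy hb
    · exact e1 b hb' hb

theorem GadgetSupport.mono {V R : Type} [Zero R] {i j x y i' j' x' y' : V}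
    {N N' : Finset V} {Γ : V → V → R} (h : GadgetSupport i' j' x' y' N' Γ) (hN : N' ⊆ N)
    (hi : i' ∈ N ∨ i' = i ∨ i' = x) (hx : x' ∈ N ∨ x' = i ∨ x' = x)
    (hj : j' ∈ N ∨ j' = j ∨ j' = y) (hy : y' ∈ N ∨ y' = j ∨ y' = y) :
    GadgetSupport i j x y N Γ := by
  intro a b h0
  rcases h a b h0 with ⟨ha, hb | rfl | rfl⟩ | ⟨rfl | rfl, hb⟩
  · exact Or.inl ⟨hN ha, Or.inl (hN hb)⟩
  · exact Or.inl ⟨hN ha, hj⟩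
  · exact Or.inl ⟨hN ha, hy⟩
  · rcases hi with hi | hi
    · exact Or.inl ⟨hi, Or.inl (hN hb)⟩
    · exact Or.inr ⟨hi, hN hb⟩
  · rcases hx with hx | hx
    · exact Or.inl ⟨hx, Or.inl (hN hb)⟩
    · exact Or.inr ⟨hx, hN hb⟩

theorem GadgetSupport.add {V R : Type} [AddZeroClass R] {i j x y : V}
    {N : Finset V} {Γ Γ' : V → V → R} (h : GadgetSupport i j x y N Γ)
    (h' : GadgetSupport i j x y N Γ') : GadgetSupport i j x y N (fun u v => Γ u v + Γ' u v) := by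
  intro a b h0
  by_cases h1 : Γ a b = 0
  · exact h' a b fun h2 => h0 (by simp [h1, h2])
  · exact h a b h1

theorem GadgetCovered.add {V R : Type} [DecidableEq V] [AddZeroClass R] {i j x y c : V}
    {N₁ N₂ : Finset V} {Γ₁ Γ₂ : V → V → R} (hc : c ∉ N₁) (hc' : c ∉ N₂) (hN : Disjoint N₁ N₂)
    (h₁ : GadgetCovered 6 i j x c N₁ Γ₁) (h₂ : GadgetCovered 6 i j c y N₂ Γ₂) :
    GadgetCovered 6 i j x y (insert c (N₁ ∪ N₂)) (fun u v => Γ₁ u v + Γ₂ u v) := by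
  intro U 𝔅 Z hU hZ hi hj hx hy hdis
  simp only [Finset.disjoint_insert_right, Finset.disjoint_union_right] at hdis
  obtain ⟨hcU, hU1, hU2⟩ := hdis
  have hU' := hU.extend_seven hZ hi hj hx hy (w := c) (c := c) (d := c) (by simpa using hcU)
  have hmem := Finset.mem_insert_self ({i, j, x, y, c, c, c} : Finset V) 𝔅
  obtain ⟨𝔅₁, hs1, hB1, hcov1⟩ := h₁ _ _ _ hU' hmem (by simp) (by simp) (by simp) (by simp)
    (by simp [hU1, hc])
  obtain ⟨𝔅₂, hs2, hB2, hcov2⟩ := h₂ _ _ _ hB1 (hs1 hmem) (by simp) (by simp) (by simp) (by simp)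
    (by simp [Finset.disjoint_union_left, hU2, hc', hN])
  refine ⟨𝔅₂, (Finset.subset_insert _ _).trans (hs1.trans hs2), ?_, ?_⟩
  · convert hB2 using 1
    ext v
    simp only [Finset.mem_union, Finset.mem_insert, Finset.mem_singleton]
    tauto
  · intro a b h
    by_cases h0 : Γ₁ a b = 0
    · exact hcov2 a b fun h1 => h (by simp [h0, h1])
    · obtain ⟨Y, hY, h⟩ := hcov1 a b h0
      exact ⟨Y, hs2 hY, h⟩

/-- The formula `φ` is simulated by a gadget. -/
def HasGadget {K ν V : Type} [CommRing K] [Fintype V] [DecidableEq V]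
    (P : Finset V → (V → V) → Prop) (i j x y : V) (N : Finset V) (φ : Formula K ν) : Prop :=
  ∃ Γ : V → V → MvPolynomial ν K, (∀ a b, IsEntry (Γ a b)) ∧ GadgetSupport i j x y N Γ ∧
    IsGadget P i j x y N φ.toPoly Γ ∧ GadgetCovered 6 i j x y N Γ

theorem exists_gadget_mul {K ν V : Type} [CommRing K] [Fintype V] [DecidableEq V]
    {P : Finset V → (V → V) → Prop} (hP : IsInsertable P) {f g : Formula K ν}
    (hf : ∀ (i j x y : V) (N : Finset V), i ∉ N → j ∉ N → x ∉ N → y ∉ N → i ≠ x → j ≠ y →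
      N.card = f.cost → HasGadget P i j x y N f)
    (hg : ∀ (i j x y : V) (N : Finset V), i ∉ N → j ∉ N → x ∉ N → y ∉ N → i ≠ x → j ≠ y →
      N.card = g.cost → HasGadget P i j x y N g)
    (i j x y : V) (N : Finset V) (hi : i ∉ N) (hj : j ∉ N) (hx : x ∉ N) (hy : y ∉ N)
    (hix : i ≠ x) (hjy : j ≠ y) (hN : N.card = (f.mul g).cost) :
    HasGadget P i j x y N (f.mul g) := by
  rw [Formula.cost] at hN
  obtain ⟨N₀, hN0, hcard0⟩ := Finset.exists_subset_card_eq (s := N) (n := 3) (by omega)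
  obtain ⟨N', rfl, hdis'⟩ : ∃ N', N = N₀ ∪ N' ∧ Disjoint N₀ N' :=
    ⟨N \ N₀, (Finset.union_sdiff_of_subset hN0).symm, Finset.disjoint_sdiff⟩
  rw [Finset.card_union_of_disjoint hdis'] at hN
  obtain ⟨N₁, hN1, hcard1⟩ := Finset.exists_subset_card_eq (s := N') (n := f.cost) (by omega)
  obtain ⟨N₂, rfl, hdis⟩ : ∃ N₂, N' = N₁ ∪ N₂ ∧ Disjoint N₁ N₂ :=
    ⟨N' \ N₁, (Finset.union_sdiff_of_subset hN1).symm, Finset.disjoint_sdiff⟩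
  rw [Finset.card_union_of_disjoint hdis] at hN
  obtain ⟨w, c, d, hwc, hwd, hcd, rfl⟩ := Finset.card_eq_three.1 hcard0
  have hdis'' := hdis'
  simp only [Finset.disjoint_insert_left, Finset.disjoint_singleton_left, Finset.mem_union,
    Finset.mem_insert, Finset.mem_singleton, not_or] at hdis'' hi hj hx hy
  obtain ⟨⟨hw1, hw2⟩, ⟨hc1, hc2⟩, hd1, hd2⟩ := hdis''
  obtain ⟨⟨hiw, hic, hid⟩, hi1, hi2⟩ := hi
  obtain ⟨⟨hjw, hjc, hjd⟩, hj1, hj2⟩ := hj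
  obtain ⟨⟨hxw, hxc, hxd⟩, hx1, hx2⟩ := hx
  obtain ⟨⟨hyw, hyc, hyd⟩, hy1, hy2⟩ := hy
  obtain ⟨Γ₁, ha1, hs1, hg1, ht1⟩ := hf i w x c N₁ hi1 hw1 hx1 hc1 hix hwc hcard1
  obtain ⟨Γ₂, ha2, hs2, hg2, ht2⟩ := hg w j d y N₂ hw2 hj2 hd2 hy2 hwd hjy (by omega)
  have hΓ0 : ∀ a b, (arrowWeight c d 1 a b + arrowWeight c w 1 a b + arrowWeight w d 1 a b :
      MvPolynomial ν K) ≠ 0 → (a = c ∨ a = w) ∧ (b = d ∨ b = w) := by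
    intro a b h
    by_contra hcon
    apply h
    have h1 : ¬ (a = c ∧ b = d) := by tauto
    have h2 : ¬ (a = c ∧ b = w) := by tauto
    have h3 : ¬ (a = w ∧ b = d) := by tauto
    simp [arrowWeight, h1, h2, h3]
  have hcase : ∀ a b, arrowWeight c d 1 a b + arrowWeight c w 1 a b + arrowWeight w d 1 a b +
      Γ₁ a b + Γ₂ a b ≠ 0 →
      ((a = c ∨ a = w) ∧ (b = d ∨ b = w)) ∨ Γ₁ a b ≠ 0 ∨ Γ₂ a b ≠ 0 := by
    intro a b h
    by_contra hcon
    simp only [not_or, not_not] at hcon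
    apply h
    rw [hcon.2.1, hcon.2.2, add_zero, add_zero]
    by_contra h0
    exact hcon.1 (hΓ0 a b h0)
  refine ⟨fun u v => arrowWeight c d 1 u v + arrowWeight c w 1 u v + arrowWeight w d 1 u v +
    Γ₁ u v + Γ₂ u v, ?_, ?_, ?_, ?_⟩
  · intro a b
    have h1 := isEntry_one (ν := ν) (K := K)
    have h2 : ∀ a b, a ∉ N₁ → b ∉ N₁ → Γ₁ a b = 0 := by
      intro a b ha hb
      by_contra h0
      rcases hs1 a b h0 with h | h
      · exact ha h.1
      · exact hb h.2
    have h3 : ∀ a b, a ∉ N₂ → b ∉ N₂ → Γ₂ a b = 0 := by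
      intro a b ha hb
      by_contra h0
      rcases hs2 a b h0 with h | h
      · exact ha h.1
      · exact hb h.2
    refine ((((isEntry_arrowWeight h1 a b).add_arrowWeight h1 ?_).add_arrowWeight h1 ?_).add
      (ha1 a b) ?_).add (ha2 a b) ?_
    · rintro rfl rfl
      simp [arrowWeight, hwd]
    · rintro rfl rfl
      simp [arrowWeight, hwc]
    · intro h
      rcases hΓ0 a b h with ⟨rfl | rfl, rfl | rfl⟩ <;> exact h2 _ _ ‹_› ‹_›
    · intro h
      by_cases h0 : Γ₁ a b = 0
      · rw [h0, add_zero] at h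
        rcases hΓ0 a b h with ⟨rfl | rfl, rfl | rfl⟩ <;> exact h3 _ _ ‹_› ‹_›
      · exact hs1.eq_zero_of_ne_zero hs2 hdis hi2 hw2 hx2 hc2 h0
  · refine GadgetSupport.add (GadgetSupport.add ?_ (hs1.mono ?_ ?_ ?_ ?_ ?_))
      (hs2.mono ?_ ?_ ?_ ?_ ?_)
    · intro a b h
      rcases hΓ0 a b h with ⟨rfl | rfl, rfl | rfl⟩ <;> simp
    · exact Finset.subset_union_left.trans Finset.subset_union_right
    · simp
    · simp
    · simp
    · simp
    · exact Finset.subset_union_right.trans Finset.subset_union_right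
    · simp
    · simp
    · simp
    · simp
  · exact IsGadget.mul hP hix hjy hwc hwd hcd hdis' hdis hg1 hg2 hs1
  · intro U 𝔅 Z hU hZ hiZ hjZ hxZ hyZ hdisU
    obtain ⟨hU0, hU1, hU2⟩ : Disjoint U {w, c, d} ∧ Disjoint U N₁ ∧ Disjoint U N₂ := by
      simpa only [Finset.disjoint_union_right] using hdisU
    have hU' := hU.extend_seven hZ hiZ hjZ hxZ hyZ hU0
    have hmem := Finset.mem_insert_self ({i, j, x, y, w, c, d} : Finset V) 𝔅
    obtain ⟨𝔅₁, hb1, hB1, hcov1⟩ := ht1 _ _ _ hU' hmem (by simp) (by simp) (by simp) (by simp)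
      (by simp [Finset.disjoint_insert_left, hU1, hw1, hc1, hd1])
    obtain ⟨𝔅₂, hb2, hB2, hcov2⟩ := ht2 _ _ _ hB1 (hb1 hmem) (by simp) (by simp) (by simp)
      (by simp) (by
        simp [Finset.disjoint_union_left, Finset.disjoint_insert_left, hU2, hw2, hc2, hd2, hdis])
    refine ⟨𝔅₂, (Finset.subset_insert _ _).trans (hb1.trans hb2), ?_, ?_⟩
    · rwa [← Finset.union_assoc, ← Finset.union_assoc]
    · intro a b h
      rcases hcase a b h with ⟨ha, hb⟩ | h | h
      · refine ⟨_, hb2 (hb1 hmem), ?_, ?_⟩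
        · rcases ha with rfl | rfl <;> simp
        · rcases hb with rfl | rfl <;> simp
      · obtain ⟨Y, hY, h⟩ := hcov1 a b h
        exact ⟨Y, hb2 hY, h⟩
      · exact hcov2 a b h

theorem exists_gadget {K ν V : Type} [CommRing K] [Fintype V] [DecidableEq V]
    {P : Finset V → (V → V) → Prop} (hP : IsInsertable P) (φ : Formula K ν) :
    ∀ (i j x y : V) (N : Finset V), i ∉ N → j ∉ N → x ∉ N → y ∉ N → i ≠ x → j ≠ y →
      N.card = φ.cost → HasGadget P i j x y N φ := by
  induction φ with
  | const a =>
    intro i j x y N hi hj hx hy hix hjy hN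
    exact exists_gadget_leaf hP (Or.inl ⟨a, rfl⟩) hi hj hx hy hix hjy hN
  | var v =>
    intro i j x y N hi hj hx hy hix hjy hN
    exact exists_gadget_leaf hP (Or.inr ⟨v, rfl⟩) hi hj hx hy hix hjy hN
  | add f g hf hg =>
    intro i j x y N hi hj hx hy hix hjy hN
    rw [Formula.cost, add_comm] at hN
    obtain ⟨c, N', hc, rfl, hN'⟩ := Finset.card_eq_succ.1 hN
    obtain ⟨N₁, hN1, hcard1⟩ := Finset.exists_subset_card_eq (s := N') (n := f.cost) (by omega)
    obtain ⟨N₂, rfl, hdis⟩ : ∃ N₂, N' = N₁ ∪ N₂ ∧ Disjoint N₁ N₂ :=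
      ⟨N' \ N₁, (Finset.union_sdiff_of_subset hN1).symm, Finset.disjoint_sdiff⟩
    rw [Finset.card_union_of_disjoint hdis] at hN'
    simp only [Finset.mem_insert, Finset.mem_union, not_or] at hc hi hj hx hy
    obtain ⟨Γ₁, ha1, hs1, hg1, ht1⟩ := hf i j x c N₁ hi.2.1 hj.2.1 hx.2.1 hc.1 hix hj.1 hcard1
    obtain ⟨Γ₂, ha2, hs2, hg2, ht2⟩ := hg i j c y N₂ hi.2.2 hj.2.2 hc.2 hy.2.2 hi.1 hjy (by omega)
    refine ⟨fun u v => Γ₁ u v + Γ₂ u v, ?_, ?_, ?_, ?_⟩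
    · exact fun a b => (ha1 a b).add (ha2 a b) fun h =>
        hs1.eq_zero_of_ne_zero hs2 hdis hi.2.2 hj.2.2 hx.2.2 hc.2 h
    · refine GadgetSupport.add (hs1.mono ?_ ?_ ?_ ?_ ?_) (hs2.mono ?_ ?_ ?_ ?_ ?_)
      · exact Finset.subset_union_left.trans (Finset.subset_insert _ _)
      · simp
      · simp
      · simp
      · simp
      · exact Finset.subset_union_right.trans (Finset.subset_insert _ _)
      · simp
      · simp
      · simp
      · simp
    · exact IsGadget.add hP hix hjy hc.1 hc.2 hdis hg1 hg2 hs1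
    · exact GadgetCovered.add hc.1 hc.2 hdis ht1 ht2
  | mul f g hf hg => exact exists_gadget_mul hP hf hg

/-! ### Permanents and hamiltonians as sums over self-maps -/

theorem sum_perm_eq_mapSum {V R : Type} [Fintype V] [DecidableEq V] [CommRing R]
    {P : Finset V → (V → V) → Prop} (hP : IsInsertable P) {Q : Equiv.Perm V → Prop}
    (h : ∀ σ : Equiv.Perm V, Q σ ↔ P Finset.univ σ) (M : V → V → R) :
    ∑ σ ∈ Finset.univ.filter Q, ∏ i, M i (σ i) = mapSum P Finset.univ M := by
  refine Finset.sum_nbij (fun σ => ⇑σ) ?_ ?_ ?_ ?_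
  · intro σ hσ
    simp only [Finset.mem_filter, Finset.mem_univ, true_and] at hσ
    simp [selfMaps, (h σ).1 hσ]
  · intro σ _ τ _ hστ
    exact DFunLike.coe_injective hστ
  · intro f hf
    simp only [selfMaps, Finset.coe_filter, Finset.mem_univ, true_and, Set.mem_ofPred_eq] at hf
    have hinj : Function.Injective f := by
      have := (hP.mapPermOn hf.2).2
      rwa [Finset.coe_univ, Set.injOn_univ] at this
    refine ⟨Equiv.ofBijective f (Finite.injective_iff_bijective.1 hinj), ?_, rfl⟩
    simp only [Finset.coe_filter, Finset.mem_univ, true_and, Set.mem_ofPred_eq]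
    exact (h _).2 hf.2
  · intro σ _
    rfl

theorem perm_eq_mapSum {m : ℕ} {R : Type} [CommRing R] (M : Matrix (Fin m) (Fin m) R) :
    perm M = mapSum MapPermOn Finset.univ (fun i j => M i j) := by
  rw [← sum_perm_eq_mapSum isInsertable_mapPermOn (Q := fun _ => True)]
  · simp [perm]
  · intro σ
    simp [MapPermOn, σ.injective.injOn]

theorem reflTransGen_iff_exists_pow {V : Type} (σ : Equiv.Perm V) (u v : V) :
    Relation.ReflTransGen (fun a b => b = σ a) u v ↔ ∃ n : ℕ, (σ ^ n) u = v := by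
  constructor
  · intro h
    induction h with
    | refl => exact ⟨0, rfl⟩
    | tail _ h ih =>
      obtain ⟨n, hn⟩ := ih
      exact ⟨n + 1, by rw [pow_succ', Equiv.Perm.mul_apply, hn, h]⟩
  · rintro ⟨n, rfl⟩
    induction n with
    | zero => exact Relation.ReflTransGen.refl
    | succ n ih => exact ih.tail (by rw [pow_succ', Equiv.Perm.mul_apply])

theorem isCycle_support_univ_iff {V : Type} [Fintype V] [DecidableEq V] [Nontrivial V]
    (σ : Equiv.Perm V) :
    (σ.IsCycle ∧ σ.support = Finset.univ) ↔ MapCyclicOn Finset.univ σ := by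
  constructor
  · rintro ⟨⟨x, -, hx⟩, hs⟩
    have hne : ∀ y, σ y ≠ y := fun y => by
      rw [← Equiv.Perm.mem_support, hs]
      exact Finset.mem_univ y
    refine ⟨fun _ _ => Finset.mem_univ _, fun u _ v _ => ?_⟩
    rw [reflTransGen_iff_exists_pow]
    have := (hx (hne u)).symm.trans (hx (hne v))
    obtain ⟨n, -, hn⟩ := this.exists_pow_eq'
    exact ⟨n, hn⟩
  · rintro ⟨-, h⟩
    have hsame : ∀ u v, σ.SameCycle u v := by
      intro u v
      obtain ⟨n, hn⟩ := (reflTransGen_iff_exists_pow σ u v).1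
        (h u (Finset.mem_univ u) v (Finset.mem_univ v))
      exact ⟨n, by simpa using hn⟩
    have hne : ∀ y, σ y ≠ y := by
      intro y hy
      obtain ⟨z, hz⟩ := exists_ne y
      obtain ⟨n, hn⟩ := hsame y z
      rw [Equiv.Perm.zpow_apply_eq_self_of_apply_eq_self hy] at hn
      exact hz hn.symm
    obtain ⟨x, -⟩ := exists_pair_ne V
    refine ⟨⟨x, hne x, fun y _ => hsame x y⟩, ?_⟩
    ext y
    simp [hne y]

theorem ham_eq_mapSum {m : ℕ} {R : Type} [CommRing R] (hm : 2 ≤ m)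
    (M : Matrix (Fin m) (Fin m) R) :
    ham M = mapSum MapCyclicOn Finset.univ (fun i j => M i j) := by
  have : Nontrivial (Fin m) := Fin.nontrivial_iff_two_le.2 hm
  rw [ham, ← sum_perm_eq_mapSum isInsertable_mapCyclicOn isCycle_support_univ_iff]
  congr!

theorem ham_eq_zero {m : ℕ} {R : Type} [CommRing R] (hm : m ≤ 1)
    (M : Matrix (Fin m) (Fin m) R) : ham M = 0 := by
  rw [ham, Finset.sum_eq_zero]
  intro σ hσ
  simp only [Finset.mem_filter] at hσ
  obtain ⟨x, hx, -⟩ := hσ.2.1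
  have := Fin.subsingleton_iff_le_one.2 hm
  exact absurd (Subsingleton.elim _ _) hx

theorem mapSum_singleton {V R : Type} [Fintype V] [DecidableEq V] [CommRing R]
    {P : Finset V → (V → V) → Prop} (hP : IsInsertable P) (u : V) (M : V → V → R) :
    mapSum P {u} M = M u u := by
  have : selfMaps P {u} = {id} := by
    ext f
    simp only [selfMaps, Finset.mem_filter, Finset.mem_univ, true_and, Finset.mem_singleton]
    constructor
    · rintro ⟨h1, h2⟩
      funext v
      by_cases hv : v = u
      · subst hv
        simpa using (hP.mapPermOn h2).1 v (by simp)
      · exact h1 v hv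
    · rintro rfl
      exact ⟨fun _ _ => rfl, hP.singleton rfl⟩
  rw [mapSum, this]
  simp

/-- Formulas are permanents and hamiltonians of matrices of bounded treewidth. -/
theorem Formula.exists_matrix {K ν : Type} [CommRing K] (φ : Formula K ν)
    {P : Finset (Fin (2 + φ.cost)) → (Fin (2 + φ.cost) → Fin (2 + φ.cost)) → Prop}
    (hP : IsInsertable P) :
    ∃ M : Matrix (Fin (2 + φ.cost)) (Fin (2 + φ.cost)) (MvPolynomial ν K),
      (∀ i j, IsEntry (M i j)) ∧ HasTreewidthAtMost (supportGraph M) 6 ∧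
      mapSum P Finset.univ (fun i j => M i j) = φ.toPoly := by
  set u : Fin (2 + φ.cost) := ⟨0, by omega⟩ with hu
  set v : Fin (2 + φ.cost) := ⟨1, by omega⟩ with hv
  have huv : u ≠ v := by simp [hu, hv]
  set N : Finset (Fin (2 + φ.cost)) := {u, v}ᶜ with hN
  have hcard : N.card = φ.cost := by
    rw [hN, Finset.card_compl, Finset.card_pair huv, Fintype.card_fin]
    omega
  have hunion : ({u, v} : Finset (Fin (2 + φ.cost))) ∪ N = Finset.univ :=
    Finset.union_compl _
  obtain ⟨Γ, hat, -, hgad, hcov⟩ := exists_gadget hP φ u v v u N (by simp [hN]) (by simp [hN])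
    (by simp [hN]) (by simp [hN]) huv huv.symm hcard
  have hdis : Disjoint {u, v} N := disjoint_compl_right
  refine ⟨fun a b => Γ a b, hat, ?_, ?_⟩
  · obtain ⟨𝔅, -, hB, hΓ⟩ := hcov {u, v} {{u, v}} {u, v}
      (BagFamily.single _ (by rw [Finset.card_pair huv]; omega)) (by simp) (by simp) (by simp)
      (by simp) (by simp) hdis
    rw [hunion] at hB
    refine hB.hasTreewidthAtMost _ ?_
    intro a b hab
    simp only [supportGraph, SimpleGraph.fromRel_adj] at hab
    rcases hab.2 with h | h
    · exact hΓ a b h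
    · obtain ⟨Y, hY, h1, h2⟩ := hΓ b a h
      exact ⟨Y, hY, h2, h1⟩
  · have := hgad {u, v} (by simp) (by simp) (by simp) (by simp) hdis (fun _ _ => 0)
      (fun _ => rfl) (fun _ => rfl) (fun _ _ _ => rfl) (fun _ _ _ => rfl)
    simp only [zero_add, hunion] at this
    rw [this, mapSum_insert hP (by simpa using huv) _ (by simp [arrowWeight, huv])]
    have hs := mapSum_singleton hP v (fun _ _ => φ.toPoly)
    rw [mapSum] at hs
    refine Eq.trans ?_ hs
    refine Finset.sum_congr rfl fun g hg => ?_
    simp only [selfMaps, Finset.mem_filter, Finset.mem_univ, true_and] at hg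
    have hgv : g v = v := by simpa using (hP.mapPermOn hg.2).1 v (by simp)
    simp [arrowWeight, hgv, huv]

theorem cost_polynomial_bound {K ν : Type} {c n : ℕ} (φ : Formula K ν)
    (h : φ.size ≤ c * (n + 1) ^ c) : 2 + φ.cost ≤ (3 * c + 2) * (n + 1) ^ (3 * c + 2) := by
  have h1 := φ.cost_le
  have h2 : (n + 1) ^ c ≤ (n + 1) ^ (3 * c + 2) := Nat.pow_le_pow_right (by omega) (by omega)
  have h3 : 1 ≤ (n + 1) ^ (3 * c + 2) := Nat.one_le_pow _ _ (by omega)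
  calc 2 + φ.cost ≤ 2 + 3 * (c * (n + 1) ^ c) := by omega
    _ ≤ 2 * (n + 1) ^ (3 * c + 2) + 3 * (c * (n + 1) ^ (3 * c + 2)) := by gcongr; omega
    _ = _ := by ring

theorem FormulaClass.permClass {K : Type} [Field K] {f : ℕ → MvPolynomial ℕ K}
    (h : FormulaClass K f) : PermClass K f := by
  obtain ⟨c, hc⟩ := h
  refine ⟨3 * c + 2, 6, fun n => ?_⟩
  obtain ⟨φ, hφ, hp⟩ := hc n
  obtain ⟨M, h1, h2, h3⟩ := φ.exists_matrix isInsertable_mapPermOn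
  exact ⟨2 + φ.cost, cost_polynomial_bound φ hφ, M, h1, h2, by rw [perm_eq_mapSum, h3, hp]⟩

theorem FormulaClass.hamClass {K : Type} [Field K] {f : ℕ → MvPolynomial ℕ K}
    (h : FormulaClass K f) : HamClass K f := by
  obtain ⟨c, hc⟩ := h
  refine ⟨3 * c + 2, 6, fun n => ?_⟩
  obtain ⟨φ, hφ, hp⟩ := hc n
  obtain ⟨M, h1, h2, h3⟩ := φ.exists_matrix isInsertable_mapCyclicOn
  exact ⟨2 + φ.cost, cost_polynomial_bound φ hφ, M, h1, h2, by
    rw [ham_eq_mapSum (by omega), h3, hp]⟩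

/-! ### Substitution in formulas, and permanents with arbitrary constants -/

/-- Substitute formulas for the variables of a formula. -/
def Formula.bind {K ν μ : Type} (s : ν → Formula K μ) : Formula K ν → Formula K μ
  | const c => const c
  | var v => s v
  | add f g => add (f.bind s) (g.bind s)
  | mul f g => mul (f.bind s) (g.bind s)

theorem Formula.size_bind {K ν μ : Type} {s : ν → Formula K μ} (hs : ∀ v, (s v).size = 1)
    (φ : Formula K ν) : (φ.bind s).size = φ.size := by
  induction φ with
  | const c => rfl
  | var v => exact hs v
  | add f g hf hg => simp only [Formula.bind, Formula.size, hf, hg]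
  | mul f g hf hg => simp only [Formula.bind, Formula.size, hf, hg]

theorem Formula.toPoly_bind {K ν μ : Type} [CommRing K] (s : ν → Formula K μ)
    (φ : Formula K ν) :
    (φ.bind s).toPoly = MvPolynomial.bind₁ (fun v => (s v).toPoly) φ.toPoly := by
  induction φ with
  | const c => simp [Formula.bind, Formula.toPoly]
  | var v => simp [Formula.bind, Formula.toPoly]
  | add f g hf hg => simp [Formula.bind, Formula.toPoly, hf, hg]
  | mul f g hf hg => simp [Formula.bind, Formula.toPoly, hf, hg]

/-- Replace the nonzero constants of a matrix by fresh variables. -/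
noncomputable def freshMatrix {K : Type} [CommRing K] {m : ℕ}
    (M : Matrix (Fin m) (Fin m) (MvPolynomial ℕ K)) :
    Matrix (Fin m) (Fin m) (MvPolynomial ℕ K) := fun i j =>
  if M i j = 0 then 0
  else if h : ∃ v, M i j = MvPolynomial.X v then MvPolynomial.X (2 * h.choose)
  else MvPolynomial.X (2 * Nat.pair i j + 1)

/-- The substitution undoing `freshMatrix`. -/
noncomputable def freshSubst {K : Type} [CommRing K] {m : ℕ}
    (M : Matrix (Fin m) (Fin m) (MvPolynomial ℕ K)) (p : ℕ) : Formula K ℕ :=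
  if p % 2 = 0 then .var (p / 2)
  else if h : (p / 2).unpair.1 < m ∧ (p / 2).unpair.2 < m then
    .const (MvPolynomial.constantCoeff (M ⟨_, h.1⟩ ⟨_, h.2⟩))
  else .const 0

theorem freshSubst_size {K : Type} [CommRing K] {m : ℕ}
    (M : Matrix (Fin m) (Fin m) (MvPolynomial ℕ K)) (p : ℕ) : (freshSubst M p).size = 1 := by
  unfold freshSubst
  split_ifs <;> rfl

theorem bind_freshMatrix {K : Type} [CommRing K] {m : ℕ}
    {M : Matrix (Fin m) (Fin m) (MvPolynomial ℕ K)} (hM : ∀ i j, IsEntry (M i j)) (i j : Fin m) :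
    MvPolynomial.bind₁ (fun v => (freshSubst M v).toPoly) (freshMatrix M i j) = M i j := by
  unfold freshMatrix
  split_ifs with h0 h
  · rw [map_zero, h0]
  · rw [MvPolynomial.bind₁_X_right, freshSubst, if_pos (by omega),
      Nat.mul_div_cancel_left _ two_pos, Formula.toPoly, ← h.choose_spec]
  · obtain ⟨a, ha⟩ := (hM i j).resolve_right h
    have h2 : (2 * Nat.pair i j + 1) / 2 = Nat.pair i j := by omega
    rw [MvPolynomial.bind₁_X_right, freshSubst, if_neg (by omega),
      dif_pos (by simp [h2]), Formula.toPoly]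
    simp [h2, ha]

theorem freshMatrix_ne_zero_iff {K : Type} [CommRing K] [Nontrivial K] {m : ℕ}
    (M : Matrix (Fin m) (Fin m) (MvPolynomial ℕ K)) (i j : Fin m) :
    freshMatrix M i j ≠ 0 ↔ M i j ≠ 0 := by
  unfold freshMatrix
  split_ifs with h0 h
  · simp [h0]
  · simp [h0]
  · simp [h0]

theorem freshMatrix_eq {K : Type} [CommRing K] {m : ℕ}
    (M : Matrix (Fin m) (Fin m) (MvPolynomial ℕ K)) (i j : Fin m) :
    freshMatrix M i j = 0 ∨ freshMatrix M i j = 1 ∨ ∃ v, freshMatrix M i j = MvPolynomial.X v := by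
  unfold freshMatrix
  split_ifs with h0 h
  · exact Or.inl rfl
  · exact Or.inr (Or.inr ⟨_, rfl⟩)
  · exact Or.inr (Or.inr ⟨_, rfl⟩)

theorem PermClass.formulaClass {K : Type} [Field K]
    (hclosed : ∀ f : ℕ → MvPolynomial ℕ K, Perm01Class K f → FormulaClass K f)
    {f : ℕ → MvPolynomial ℕ K} (h : PermClass K f) : FormulaClass K f := by
  obtain ⟨c, k, h⟩ := h
  choose m hm M hat htw hper using h
  obtain ⟨d, hd⟩ := hclosed (fun n => perm (freshMatrix (M n)))
    ⟨c, k, fun n => ⟨m n, hm n, freshMatrix (M n), freshMatrix_eq _, by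
      have : supportGraph (freshMatrix (M n)) = supportGraph (M n) := by
        simp only [supportGraph, freshMatrix_ne_zero_iff]
      rw [this]
      exact htw n, rfl⟩⟩
  refine ⟨d, fun n => ?_⟩
  obtain ⟨φ, hφ, hp⟩ := hd n
  refine ⟨φ.bind (freshSubst (M n)), ?_, ?_⟩
  · rwa [Formula.size_bind (freshSubst_size _)]
  · rw [Formula.toPoly_bind, hp, ← hper n]
    simp only [perm, map_sum, map_prod, bind_freshMatrix (hat n)]

/-! ### Contracting a part of a cyclic map onto a separator -/

/-- The trace on `S` of a partial map `g`, defined on `B ∪ D` with `D ⊆ S`, determines whether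
the extensions of `g` are cyclic. -/
theorem exists_contraction {V : Type} [DecidableEq V] {D S : Finset V} (hDS : D ⊆ S)
    (hS : S.Nonempty) (B : Finset V) (hSB : Disjoint S B) (g : V → V)
    (hg : ∀ v ∈ B ∪ D, g v ∈ B ∪ S) :
    ∃ o : Option (V → V), (∀ ρ ∈ o, (∀ v ∈ S, ρ v ∈ S) ∧ ∀ v ∉ S, ρ v = v) ∧
      ∀ (W : Finset V) (f : V → V), S ⊆ W → Disjoint W B → (∀ v ∈ B ∪ D, f v = g v) →
        (∀ v ∈ W \ D, f v ∈ W) →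
        (MapCyclicOn (W ∪ B) f ↔
          ∃ ρ ∈ o, MapCyclicOn W fun v => if v ∈ D then ρ v else f v) := by
  induction B using Finset.induction_on generalizing g with
  | empty =>
    refine ⟨some fun v => if v ∈ D then g v else v, ?_, ?_⟩
    · intro ρ hρ
      obtain rfl := Option.mem_some_iff.1 hρ
      refine ⟨fun v hv => ?_, fun v hv => if_neg fun h => hv (hDS h)⟩
      by_cases h : v ∈ D
      · simpa [h] using hg v (by simpa using h)
      · simpa [h] using hv
    · intro W f _ _ hf _
      rw [Finset.union_empty]
      simp only [Option.mem_def, Option.some.injEq, exists_eq_left']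
      refine mapCyclicOn_congr fun v _ => ?_
      by_cases h : v ∈ D
      · simpa [h] using hf v (by simpa using h)
      · simp [h]
  | insert b B hb ih =>
    have hbS : b ∉ S := fun h => Finset.disjoint_left.1 hSB h (Finset.mem_insert_self _ _)
    have hSB' : Disjoint S B := hSB.mono_right (Finset.subset_insert _ _)
    have hunion : ∀ W : Finset V, W ∪ insert b B = insert b (W ∪ B) := fun W =>
      Finset.union_insert _ _ _
    have hbW : ∀ W : Finset V, Disjoint W (insert b B) → b ∉ W ∪ B := fun W hW h =>
      (Finset.mem_union.1 h).elim
        (fun h => Finset.disjoint_left.1 hW h (Finset.mem_insert_self _ _)) hb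
    have hne : ∀ W : Finset V, S ⊆ W → (W ∪ B).Nonempty := fun W hW =>
      (hS.mono hW).mono Finset.subset_union_left
    by_cases hbb : g b = b
    · refine ⟨none, by simp, fun W f hSW hW hf _ => ?_⟩
      simp only [Option.mem_def, reduceCtorEq, false_and, exists_false, iff_false]
      intro hcyc
      rw [hunion] at hcyc
      obtain ⟨u, hu, hub⟩ := ((mapCyclicOn_insert (hbW W hW) (hne W hSW) f).1 hcyc).1
      have hfb : f b = b := (hf b (by simp)).trans hbb
      have := hcyc.mapPermOn.2 (by simp [Finset.mem_union.1 hu]) (by simp) (hub.trans hfb.symm)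
      exact hbW W hW (this ▸ hu)
    by_cases hpre : ∃ u ∈ B ∪ D, g u = b
    swap
    · refine ⟨none, by simp, fun W f hSW hW hf hfW => ?_⟩
      simp only [Option.mem_def, reduceCtorEq, false_and, exists_false, iff_false]
      intro hcyc
      rw [hunion] at hcyc
      obtain ⟨u, hu, hub⟩ := ((mapCyclicOn_insert (hbW W hW) (hne W hSW) f).1 hcyc).1
      by_cases huBD : u ∈ B ∪ D
      · refine hpre ⟨u, huBD, ?_⟩
        rw [← hf u (by simp only [Finset.mem_union, Finset.mem_insert] at huBD ⊢; tauto), hub]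
      · have huW : u ∈ W \ D := by
          simp only [Finset.mem_union, Finset.mem_sdiff] at hu huBD ⊢
          tauto
        exact hbW W hW (Finset.mem_union_left _ (hub ▸ hfW u huW))
    have hg' : ∀ v ∈ B ∪ D, bypass b g v ∈ B ∪ S := by
      intro v hv
      unfold bypass
      split_ifs with h
      · have := hg b (by simp)
        rw [Finset.insert_union] at this
        exact (Finset.mem_insert.1 this).resolve_left hbb
      · have := hg v (by rw [Finset.insert_union]; exact Finset.mem_insert_of_mem hv)
        rw [Finset.insert_union] at this
        exact (Finset.mem_insert.1 this).resolve_left h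
    obtain ⟨o, ho, hW⟩ := ih hSB' (bypass b g) hg'
    refine ⟨o, ho, fun W f hSW hWB hf hfW => ?_⟩
    have hfb : f b = g b := hf b (by simp)
    have hfBD : ∀ v ∈ B ∪ D, f v = g v := fun v hv =>
      hf v (by rw [Finset.insert_union]; exact Finset.mem_insert_of_mem hv)
    have hfne : ∀ v ∈ W \ D, f v ≠ b := fun v hv h =>
      hbW W hWB (Finset.mem_union_left _ (h ▸ hfW v hv))
    rw [hunion, mapCyclicOn_insert (hbW W hWB) (hne W hSW),
      hW W (bypass b f) hSW (hWB.mono_right (Finset.subset_insert _ _))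
        (fun v hv => by simp only [bypass, hfBD v hv, hfb])
        (fun v hv => by simpa only [bypass, if_neg (hfne v hv)] using hfW v hv)]
    have hex : ∃ u ∈ W ∪ B, f u = b := by
      obtain ⟨u, hu, hub⟩ := hpre
      refine ⟨u, ?_, (hfBD u hu).trans hub⟩
      rcases Finset.mem_union.1 hu with h | h
      · exact Finset.mem_union_right _ h
      · exact Finset.mem_union_left _ (hSW (hDS h))
    simp only [hex, true_and]
    refine exists_congr fun ρ => and_congr_right fun _ => mapCyclicOn_congr fun v hv => ?_
    by_cases h : v ∈ D
    · simp [h]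
    · simp [h, bypass, hfne v (Finset.mem_sdiff.2 ⟨hv, h⟩)]

/-- The maps sending `v ∈ U` into `A v` and fixing the points outside `U`. -/
def restrictedMaps {V : Type} [Fintype V] [DecidableEq V] (U : Finset V) (A : V → Finset V) :
    Finset (V → V) :=
  Fintype.piFinset fun v => if v ∈ U then A v else {v}

theorem mem_restrictedMaps {V : Type} [Fintype V] [DecidableEq V] {U : Finset V}
    {A : V → Finset V} {f : V → V} :
    f ∈ restrictedMaps U A ↔ (∀ v ∈ U, f v ∈ A v) ∧ ∀ v ∉ U, f v = v := by
  simp only [restrictedMaps, Fintype.mem_piFinset]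
  constructor
  · intro h
    exact ⟨fun v hv => by simpa [hv] using h v, fun v hv => by simpa [hv] using h v⟩
  · rintro ⟨h1, h2⟩ v
    by_cases hv : v ∈ U
    · simpa [hv] using h1 v hv
    · simpa [hv] using h2 v hv

theorem mapSum_eq_sum_restrictedMaps {V R : Type} [Fintype V] [DecidableEq V] [CommRing R]
    {P : Finset V → (V → V) → Prop} (hP : IsInsertable P) {U : Finset V} {A : V → Finset V}
    {M : V → V → R} (hM : ∀ v ∈ U, ∀ j ∈ U, j ∉ A v → M v j = 0) :
    mapSum P U M =
      ∑ f ∈ restrictedMaps U A, if P U f then ∏ v ∈ U, M v (f v) else 0 := by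
  rw [← Finset.sum_filter, mapSum]
  symm
  refine Finset.sum_subset ?_ ?_
  · intro f hf
    simp only [Finset.mem_filter, mem_restrictedMaps, selfMaps, Finset.mem_univ,
      true_and] at hf ⊢
    exact ⟨hf.1.2, hf.2⟩
  · intro f hf hf'
    simp only [Finset.mem_filter, mem_restrictedMaps, selfMaps, Finset.mem_univ,
      true_and] at hf hf'
    have : ∃ v ∈ U, f v ∉ A v := by
      by_contra! h
      exact hf' ⟨⟨h, hf.1⟩, hf.2⟩
    obtain ⟨v, hv, hvA⟩ := this
    exact Finset.prod_eq_zero hv (hM v hv _ ((hP.mapPermOn hf.2).1 v hv) hvA)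

theorem sum_restrictedMaps_split {V R : Type} [Fintype V] [DecidableEq V] [CommRing R]
    {E F : Finset V} (hEF : Disjoint E F) (A : V → Finset V) (Φ : (V → V) → R) :
    ∑ f ∈ restrictedMaps (E ∪ F) A, Φ f =
      ∑ g ∈ restrictedMaps E A, ∑ h ∈ restrictedMaps F A,
        Φ fun v => if v ∈ E then g v else h v := by
  rw [← Finset.sum_product']
  symm
  refine Finset.sum_nbij' (fun p v => if v ∈ E then p.1 v else p.2 v)
    (fun f => (fun v => if v ∈ E then f v else v, fun v => if v ∈ F then f v else v))
    ?_ ?_ ?_ ?_ ?_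
  · rintro ⟨g, h⟩ hp
    simp only [Finset.mem_product, mem_restrictedMaps] at hp ⊢
    refine ⟨fun v hv => ?_, fun v hv => ?_⟩
    · by_cases hE : v ∈ E
      · simpa [hE] using hp.1.1 v hE
      · simpa [hE] using hp.2.1 v ((Finset.mem_union.1 hv).resolve_left hE)
    · rw [Finset.mem_union, not_or] at hv
      simpa [hv.1] using hp.2.2 v hv.2
  · intro f hf
    simp only [Finset.mem_product, mem_restrictedMaps] at hf ⊢
    exact ⟨⟨fun v hv => by simpa [hv] using hf.1 v (by simp [hv]), fun v hv => by simp [hv]⟩,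
      ⟨fun v hv => by simpa [hv] using hf.1 v (by simp [hv]), fun v hv => by simp [hv]⟩⟩
  · rintro ⟨g, h⟩ hp
    simp only [Finset.mem_product, mem_restrictedMaps] at hp
    refine Prod.ext (funext fun v => ?_) (funext fun v => ?_)
    · by_cases hE : v ∈ E
      · simp [hE]
      · simp [hE, hp.1.2 v hE]
    · by_cases hF : v ∈ F
      · simp [hF, Finset.disjoint_right.1 hEF hF]
      · simp [hF, hp.2.2 v hF]
  · intro f hf
    simp only [mem_restrictedMaps, Finset.mem_union] at hf
    funext v
    by_cases hE : v ∈ E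
    · simp [hE]
    · by_cases hF : v ∈ F
      · simp [hE, hF]
      · simp [hE, hF, hf.2 v (by tauto)]
  · rintro ⟨g, h⟩ _
    rfl

/-- Replace the rows of `M` indexed by `D` by the unit rows given by `ρ`. -/
def unitRows {V R : Type} [DecidableEq V] [Zero R] [One R] (D : Finset V) (ρ : V → V)
    (M : V → V → R) : V → V → R :=
  fun v j => if v ∈ D then (if j = ρ v then 1 else 0) else M v j

theorem mapSum_unitRows {V R : Type} [Fintype V] [DecidableEq V] [CommRing R]
    {P : Finset V → (V → V) → Prop} (hP : IsInsertable P) {D W : Finset V} (hDW : D ⊆ W)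
    {ρ : V → V} (M : V → V → R) :
    mapSum P W (unitRows D ρ M) = ∑ h ∈ restrictedMaps (W \ D) (fun _ => W),
      if P W (fun v => if v ∈ D then ρ v else h v) then ∏ v ∈ W \ D, M v (h v) else 0 := by
  have hW : D ∪ W \ D = W := Finset.union_sdiff_of_subset hDW
  rw [mapSum_eq_sum_restrictedMaps hP (A := fun v => if v ∈ D then {ρ v} else W)]
  · conv_lhs => rw [← hW]
    rw [sum_restrictedMaps_split Finset.disjoint_sdiff, hW]
    have h1 : restrictedMaps D (fun v => if v ∈ D then {ρ v} else W) =
        {fun v => if v ∈ D then ρ v else v} := by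
      ext f
      simp only [mem_restrictedMaps, Finset.mem_singleton, funext_iff]
      constructor
      · rintro ⟨h1, h2⟩ v
        by_cases hv : v ∈ D
        · simpa [hv] using h1 v hv
        · simpa [hv] using h2 v hv
      · intro h
        exact ⟨fun v hv => by simp [h v, hv], fun v hv => by simp [h v, hv]⟩
    have h2 : restrictedMaps (W \ D) (fun v => if v ∈ D then {ρ v} else W) =
        restrictedMaps (W \ D) (fun _ => W) := by
      ext f
      simp only [mem_restrictedMaps]
      refine and_congr_left fun _ => forall₂_congr fun v hv => ?_
      simp [(Finset.mem_sdiff.1 hv).2]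
    rw [h1, h2, Finset.sum_singleton]
    refine Finset.sum_congr rfl fun h _ => ?_
    have h3 : (fun v => if v ∈ D then (if v ∈ D then ρ v else v) else h v) =
        fun v => if v ∈ D then ρ v else h v := by
      funext v
      split_ifs <;> rfl
    rw [h3, ← Finset.prod_sdiff hDW]
    have h4 : ∏ v ∈ D, unitRows D ρ M v (if v ∈ D then ρ v else h v) = 1 :=
      Finset.prod_eq_one fun v hv => by simp [unitRows, hv]
    have h5 : ∏ v ∈ W \ D, unitRows D ρ M v (if v ∈ D then ρ v else h v) =
        ∏ v ∈ W \ D, M v (h v) :=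
      Finset.prod_congr rfl fun v hv => by simp [unitRows, (Finset.mem_sdiff.1 hv).2]
    rw [h4, h5, mul_one]
  · intro v _ j hj hjA
    by_cases h : v ∈ D
    · simp only [h, if_true, Finset.mem_singleton] at hjA
      simp [unitRows, h, hjA]
    · simp [h, hj] at hjA

theorem exists_contraction_weights {V R : Type} [Fintype V] [DecidableEq V] [CommRing R]
    {D S B : Finset V} (hDS : D ⊆ S) (hS : S.Nonempty) (hSB : Disjoint S B) (N : V → V → R) :
    ∃ T : (V → V) → R, ∀ (W : Finset V) (M : V → V → R), S ⊆ W → Disjoint W B →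
      (∀ v ∈ B ∪ D, ∀ j, M v j = N v j) → (∀ v ∈ B ∪ D, ∀ j ∈ W \ S, M v j = 0) →
      (∀ v ∈ W \ D, ∀ j ∈ B, M v j = 0) →
      mapSum MapCyclicOn (W ∪ B) M = ∑ ρ ∈ restrictedMaps S (fun _ => S),
        T ρ * mapSum MapCyclicOn W (unitRows D ρ M) := by
  have hex : ∀ g ∈ restrictedMaps (B ∪ D) (fun _ => B ∪ S), _ := fun g hg =>
    exists_contraction hDS hS B hSB g (mem_restrictedMaps.1 hg).1
  choose! o ho hoW using hex
  refine ⟨fun ρ => ∑ g ∈ restrictedMaps (B ∪ D) (fun _ => B ∪ S),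
    if o g = some ρ then ∏ v ∈ B ∪ D, N v (g v) else 0, ?_⟩
  intro W M hSW hWB hMN hM1 hM2
  have hDW := hDS.trans hSW
  have hDB : Disjoint D B := hSB.mono_left hDS
  have hdis : Disjoint (B ∪ D) (W \ D) := by
    rw [Finset.disjoint_union_left]
    exact ⟨hWB.symm.mono_right Finset.sdiff_subset, Finset.disjoint_sdiff⟩
  have hU : W ∪ B = (B ∪ D) ∪ W \ D := by
    rw [Finset.union_assoc, Finset.union_sdiff_of_subset hDW, Finset.union_comm]
  rw [mapSum_eq_sum_restrictedMaps isInsertable_mapCyclicOn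
    (A := fun v => if v ∈ B ∪ D then B ∪ S else W)]
  rotate_left
  · intro v hv j hj hjA
    by_cases h : v ∈ B ∪ D
    · refine hM1 v h j ?_
      simp only [h, if_true, Finset.mem_union, Finset.mem_sdiff] at hjA hj ⊢
      tauto
    · refine hM2 v ?_ j ?_
      · rw [hU] at hv
        exact (Finset.mem_union.1 hv).resolve_left h
      · simp only [h, if_false] at hjA
        exact (Finset.mem_union.1 hj).resolve_left hjA
  conv_lhs => rw [hU]
  rw [sum_restrictedMaps_split hdis, ← hU]
  have h1 : restrictedMaps (B ∪ D) (fun v => if v ∈ B ∪ D then B ∪ S else W) =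
      restrictedMaps (B ∪ D) (fun _ => B ∪ S) := by
    ext f
    simp only [mem_restrictedMaps]
    refine and_congr_left fun _ => forall₂_congr fun v hv => ?_
    rw [if_pos hv]
  have h2 : restrictedMaps (W \ D) (fun v => if v ∈ B ∪ D then B ∪ S else W) =
      restrictedMaps (W \ D) (fun _ => W) := by
    ext f
    simp only [mem_restrictedMaps]
    refine and_congr_left fun _ => forall₂_congr fun v hv => ?_
    rw [if_neg (Finset.disjoint_right.1 hdis hv)]
  rw [h1, h2]
  simp only [Finset.sum_mul]
  conv_rhs => rw [Finset.sum_comm]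
  refine Finset.sum_congr rfl fun g hg => ?_
  have hpt : ∀ h ∈ restrictedMaps (W \ D) (fun _ => W),
      (if MapCyclicOn (W ∪ B) (fun v => if v ∈ B ∪ D then g v else h v) then
        ∏ v ∈ W ∪ B, M v (if v ∈ B ∪ D then g v else h v) else 0) =
      ∑ ρ ∈ restrictedMaps S (fun _ => S),
        (if o g = some ρ then ∏ v ∈ B ∪ D, N v (g v) else 0) *
          if MapCyclicOn W (fun v => if v ∈ D then ρ v else h v) then
            ∏ v ∈ W \ D, M v (h v) else 0 := by
    intro h hh
    have hprod : ∏ v ∈ W ∪ B, M v (if v ∈ B ∪ D then g v else h v) =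
        (∏ v ∈ B ∪ D, N v (g v)) * ∏ v ∈ W \ D, M v (h v) := by
      rw [hU, Finset.prod_union hdis]
      congr 1
      · exact Finset.prod_congr rfl fun v hv => by rw [if_pos hv, hMN v hv]
      · exact Finset.prod_congr rfl fun v hv => by
          rw [if_neg (Finset.disjoint_right.1 hdis hv)]
    have hiff := hoW g hg W (fun v => if v ∈ B ∪ D then g v else h v) hSW hWB
      (fun v hv => if_pos hv) (fun v hv => by
        simpa only [if_neg (Finset.disjoint_right.1 hdis hv)] using
          (mem_restrictedMaps.1 hh).1 v hv)
    have hcongr : ∀ ρ : V → V,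
        MapCyclicOn W (fun v => if v ∈ D then ρ v else if v ∈ B ∪ D then g v else h v) ↔
        MapCyclicOn W (fun v => if v ∈ D then ρ v else h v) := fun ρ =>
      mapCyclicOn_congr fun v hv => by
        by_cases hvD : v ∈ D
        · simp [hvD]
        · simp [hvD, Finset.disjoint_left.1 hWB hv]
    simp only [hcongr] at hiff
    rw [hprod]
    rcases hog : o g with _ | ρ
    · rw [hog] at hiff
      simp only [Option.mem_def, reduceCtorEq, false_and, exists_false, iff_false] at hiff
      rw [if_neg hiff]
      simp
    · have hρ : ρ ∈ restrictedMaps S (fun _ => S) := mem_restrictedMaps.2 (ho g hg ρ hog)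
      rw [hog] at hiff
      simp only [Option.mem_def, Option.some.injEq, exists_eq_left'] at hiff
      rw [Finset.sum_eq_single_of_mem ρ hρ]
      · simp only [hiff, if_true, mul_ite, mul_zero]
      · intro ρ' _ hne
        simp [hne.symm]
  rw [Finset.sum_congr rfl hpt, Finset.sum_comm]
  refine Finset.sum_congr rfl fun ρ _ => ?_
  rw [mapSum_unitRows isInsertable_mapCyclicOn hDW, Finset.mul_sum]

/-! ### Splitting a hamiltonian along a separator -/

theorem mapSum_row_expansion {V R : Type} [Fintype V] [DecidableEq V] [CommRing R]
    (P : Finset V → (V → V) → Prop) {S U : Finset V} (hSU : S ⊆ U) {M M₁ M₂ : V → V → R}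
    (h : ∀ v ∈ S, ∀ j, M v j = M₁ v j + M₂ v j) :
    mapSum P U M = ∑ D ∈ S.powerset,
      mapSum P U fun v j => if v ∈ S then (if v ∈ D then M₁ v j else M₂ v j) else M v j := by
  unfold mapSum
  rw [Finset.sum_comm]
  refine Finset.sum_congr rfl fun f _ => ?_
  rw [← Finset.prod_sdiff hSU, Finset.prod_congr rfl fun v hv => h v hv (f v),
    Finset.prod_add, Finset.mul_sum]
  refine Finset.sum_congr rfl fun D hD => ?_
  have hDS := Finset.mem_powerset.1 hD
  rw [← Finset.prod_sdiff hSU, ← Finset.prod_sdiff hDS, mul_comm (∏ v ∈ D, M₁ v (f v))]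
  congr 1
  · exact Finset.prod_congr rfl fun v hv => by simp [(Finset.mem_sdiff.1 hv).2]
  · congr 1
    · exact Finset.prod_congr rfl fun v hv => by simp [Finset.mem_sdiff.1 hv]
    · exact Finset.prod_congr rfl fun v hv => by simp [hDS hv, hv]

theorem LinearMap.exists_generalizedInverse {K E F : Type} [Field K] [AddCommGroup E]
    [AddCommGroup F] [Module K E] [Module K F] (p : E →ₗ[K] F) :
    ∃ g : F →ₗ[K] E, ∀ x, p (g (p x)) = p x := by
  obtain ⟨r, hr⟩ := p.rangeRestrict.exists_rightInverse_of_surjective p.range_rangeRestrict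
  obtain ⟨g, hg⟩ := LinearMap.exists_extend r
  refine ⟨g, fun x => ?_⟩
  have h1 : g (p x) = r (p.rangeRestrict x) := LinearMap.congr_fun hg (p.rangeRestrict x)
  have h2 := LinearMap.congr_fun hr (p.rangeRestrict x)
  rw [h1]
  exact congrArg Subtype.val h2

theorem exists_generalizedInverse_finset {K ι : Type} [Field K] [DecidableEq ι] (s : Finset ι)
    (P : ι → ι → K) :
    ∃ G : ι → ι → K, ∀ i ∈ s, ∀ j ∈ s,
      P i j = ∑ b ∈ s, ∑ a ∈ s, P i b * G b a * P a j := by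
  let Q : Matrix s s K := Matrix.of fun i j => P i j
  obtain ⟨g, hg⟩ := LinearMap.exists_generalizedInverse (Matrix.toLin' Q)
  have hQ : Q * LinearMap.toMatrix' g * Q = Q := by
    apply Matrix.toLin'.injective
    refine LinearMap.ext fun x => ?_
    rw [Matrix.toLin'_mul, Matrix.toLin'_mul, Matrix.toLin'_toMatrix']
    exact hg x
  refine ⟨fun b a => if h : b ∈ s ∧ a ∈ s then LinearMap.toMatrix' g ⟨b, h.1⟩ ⟨a, h.2⟩ else 0,
    fun i hi j hj => ?_⟩
  have := congrFun (congrFun hQ ⟨i, hi⟩) ⟨j, hj⟩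
  rw [Matrix.mul_assoc, Matrix.mul_apply] at this
  simp only [Matrix.mul_apply, Q, Matrix.of_apply] at this
  rw [← this, ← Finset.sum_coe_sort s]
  refine Finset.sum_congr rfl fun b _ => ?_
  rw [Finset.mul_sum, ← Finset.sum_coe_sort s]
  refine Finset.sum_congr rfl fun a _ => ?_
  simp [mul_assoc]

/-- Restrict the rows of `M` in `S` to the columns in `B`, for the rows in `D`, or to the columns
outside `B`, for the rows not in `D`. -/
def sepRows {V R : Type} [DecidableEq V] [Zero R] (S B D : Finset V) (M : V → V → R) :
    V → V → R :=
  fun v j => if v ∈ S then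
    (if v ∈ D then (if j ∈ B then M v j else 0) else (if j ∈ B then 0 else M v j)) else M v j

theorem mapSum_eq_sum_sepRows {V R : Type} [Fintype V] [DecidableEq V] [CommRing R]
    (P : Finset V → (V → V) → Prop) {S U : Finset V} (hSU : S ⊆ U) (B : Finset V)
    (M : V → V → R) :
    mapSum P U M = ∑ D ∈ S.powerset, mapSum P U (sepRows S B D M) := by
  refine mapSum_row_expansion P hSU (M₁ := fun v j => if j ∈ B then M v j else 0)
    (M₂ := fun v j => if j ∈ B then 0 else M v j) fun v _ j => ?_
  by_cases h : j ∈ B <;> simp [h]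

theorem mapSum_unitRows_unitRows {V R : Type} [Fintype V] [DecidableEq V] [CommRing R]
    {P : Finset V → (V → V) → Prop} (hP : IsInsertable P) {D S : Finset V} (hDS : D ⊆ S)
    (ρ ρ' : V → V) (M : V → V → R) :
    mapSum P S (unitRows (S \ D) ρ' (unitRows D ρ M)) =
      if P S (fun v => if v ∈ D then ρ v else ρ' v) then 1 else 0 := by
  have hcongr : ∀ (f g : V → V), (∀ u ∈ S, f u = g u) → (P S f ↔ P S g) := fun f g h =>
    ⟨hP.congr h, hP.congr fun u hu => (h u hu).symm⟩
  rw [mapSum_unitRows hP Finset.sdiff_subset, Finset.sdiff_sdiff_eq_self hDS]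
  by_cases hρ : ∀ v ∈ D, ρ v ∈ S
  · rw [Finset.sum_eq_single (fun v => if v ∈ D then ρ v else v)]
    · have h1 : ∏ v ∈ D, unitRows D ρ M v (if v ∈ D then ρ v else v) = 1 :=
        Finset.prod_eq_one fun v hv => by simp [unitRows, hv]
      rw [h1]
      refine if_congr (hcongr _ _ fun v hv => ?_) rfl rfl
      by_cases hvD : v ∈ D <;> simp [hv, hvD]
    · intro h hh hne
      rw [mem_restrictedMaps] at hh
      have : ∃ v ∈ D, h v ≠ ρ v := by
        by_contra! hcon
        refine hne (funext fun v => ?_)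
        by_cases hv : v ∈ D
        · simp [hv, hcon v hv]
        · simp [hv, hh.2 v hv]
      obtain ⟨v, hv, hvρ⟩ := this
      rw [Finset.prod_eq_zero hv (by simp [unitRows, hv, hvρ]), ite_self]
    · intro h
      refine absurd (mem_restrictedMaps.2 ⟨fun v hv => ?_, fun v hv => ?_⟩) h
      · simpa [hv] using hρ v hv
      · simp [hv]
  · push Not at hρ
    obtain ⟨v, hv, hvS⟩ := hρ
    rw [if_neg, Finset.sum_eq_zero]
    · intro h hh
      rw [mem_restrictedMaps] at hh
      rw [Finset.prod_eq_zero hv, ite_self]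
      have : h v ≠ ρ v := fun heq => hvS (heq ▸ hh.1 v hv)
      simp [unitRows, hv, this]
    · intro h
      have := (hP.mapPermOn h).1 v (hDS hv)
      simp only [hv, if_true] at this
      exact hvS this

/-- Splitting a hamiltonian along a separator `S` between `A` and `B`. -/
theorem mapSum_separator {K V R : Type} [Field K] [Fintype V] [DecidableEq V] [CommRing R]
    [Algebra K R] {A S B : Finset V} (hS : S.Nonempty) (hSA : Disjoint S A) (hSB : Disjoint S B)
    (hAB : Disjoint A B) {M : V → V → R} (hM : ∀ a ∈ A, ∀ b ∈ B, M a b = 0 ∧ M b a = 0) :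
    ∃ G : Finset V → (V → V) → (V → V) → K,
      mapSum MapCyclicOn (A ∪ S ∪ B) M = ∑ D ∈ S.powerset,
        ∑ ρ ∈ restrictedMaps S (fun _ => S), ∑ ρ' ∈ restrictedMaps S (fun _ => S),
          algebraMap K R (G D ρ ρ') *
            (mapSum MapCyclicOn (A ∪ S) (unitRows D ρ (sepRows S B D M)) *
              mapSum MapCyclicOn (B ∪ S) (unitRows (S \ D) ρ' (sepRows S B D M))) := by
  choose G hG using fun D : Finset V => exists_generalizedInverse_finset (K := K)
    (restrictedMaps S (fun _ => S)) fun ρ' ρ =>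
      if MapCyclicOn S (fun v => if v ∈ D then ρ v else ρ' v) then 1 else 0
  refine ⟨G, ?_⟩
  rw [mapSum_eq_sum_sepRows _ (S := S) (Finset.subset_union_right.trans Finset.subset_union_left) B]
  refine Finset.sum_congr rfl fun D hD => ?_
  have hDS := Finset.mem_powerset.1 hD
  have hswap : ∀ ρ ρ', unitRows D ρ (unitRows (S \ D) ρ' (sepRows S B D M)) =
      unitRows (S \ D) ρ' (unitRows D ρ (sepRows S B D M)) := by
    intro ρ ρ'
    funext v j
    by_cases hv : v ∈ D <;> simp [unitRows, hv]
  have hNB : ∀ v, v ∉ B → v ∉ D → ∀ j ∈ B, (v ∈ A ∨ v ∈ S) → sepRows S B D M v j = 0 := by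
    intro v hvB hvD j hj hv
    by_cases hvS : v ∈ S
    · simp [sepRows, hvS, hvD, hj]
    · simp [sepRows, hvS, (hM v (hv.resolve_right hvS) j hj).1]
  have hNA : ∀ v ∈ B ∪ D, ∀ j ∈ A, sepRows S B D M v j = 0 := by
    intro v hv j hj
    have hjB := Finset.disjoint_left.1 hAB hj
    rcases Finset.mem_union.1 hv with h | h
    · have hvS := Finset.disjoint_right.1 hSB h
      simp [sepRows, hvS, (hM j hj v h).2]
    · simp [sepRows, hDS h, h, hjB]
  set N := sepRows S B D M with hN
  obtain ⟨TB, hTB⟩ := exists_contraction_weights hDS hS hSB N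
  obtain ⟨TA, hTA⟩ := exists_contraction_weights (Finset.sdiff_subset (s := S) (t := D)) hS hSA N
  have hρS : ∀ ρ ∈ restrictedMaps S (fun _ => S), ∀ v ∈ S, ρ v ∈ S := fun ρ hρ =>
    (mem_restrictedMaps.1 hρ).1
  have hU : mapSum MapCyclicOn (A ∪ S ∪ B) N = ∑ ρ ∈ restrictedMaps S (fun _ => S),
      TB ρ * mapSum MapCyclicOn (A ∪ S) (unitRows D ρ N) := by
    refine hTB (A ∪ S) N Finset.subset_union_right
      (Finset.disjoint_union_left.2 ⟨hAB, hSB⟩) (fun _ _ _ => rfl) ?_ ?_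
    · intro v hv j hj
      refine hNA v hv j ?_
      obtain ⟨h1, h2⟩ := Finset.mem_sdiff.1 hj
      exact (Finset.mem_union.1 h1).resolve_right h2
    · intro v hv j hj
      obtain ⟨h1, h2⟩ := Finset.mem_sdiff.1 hv
      refine hNB v ?_ h2 j hj (Finset.mem_union.1 h1)
      rcases Finset.mem_union.1 h1 with h | h
      · exact Finset.disjoint_left.1 hAB h
      · exact Finset.disjoint_left.1 hSB h
  have hA : ∀ ρ ∈ restrictedMaps S (fun _ => S),
      mapSum MapCyclicOn (A ∪ S) (unitRows D ρ N) = ∑ ρ' ∈ restrictedMaps S (fun _ => S),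
        TA ρ' * if MapCyclicOn S (fun v => if v ∈ D then ρ v else ρ' v) then 1 else 0 := by
    intro ρ hρ
    rw [Finset.union_comm, hTA S (unitRows D ρ N) subset_rfl hSA]
    · refine Finset.sum_congr rfl fun ρ' _ => ?_
      rw [mapSum_unitRows_unitRows isInsertable_mapCyclicOn hDS]
    · intro v hv j
      have : v ∉ D := by
        rcases Finset.mem_union.1 hv with h | h
        · exact fun h' => Finset.disjoint_right.1 hSA h (hDS h')
        · exact (Finset.mem_sdiff.1 h).2
      simp [unitRows, this]
    · simp
    · intro v hv j hj
      rw [Finset.sdiff_sdiff_eq_self hDS] at hv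
      have : j ≠ ρ v := fun h => Finset.disjoint_right.1 hSA hj (h ▸ hρS ρ hρ v (hDS hv))
      simp [unitRows, hv, this]
  have hB : ∀ ρ' ∈ restrictedMaps S (fun _ => S),
      mapSum MapCyclicOn (B ∪ S) (unitRows (S \ D) ρ' N) =
        ∑ ρ ∈ restrictedMaps S (fun _ => S),
          TB ρ * if MapCyclicOn S (fun v => if v ∈ D then ρ v else ρ' v) then 1 else 0 := by
    intro ρ' hρ'
    rw [Finset.union_comm, hTB S (unitRows (S \ D) ρ' N) subset_rfl hSB]
    · refine Finset.sum_congr rfl fun ρ hρ => ?_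
      rw [hswap, mapSum_unitRows_unitRows isInsertable_mapCyclicOn hDS]
    · intro v hv j
      have : v ∉ S \ D := by
        rcases Finset.mem_union.1 hv with h | h
        · exact fun h' => Finset.disjoint_right.1 hSB h (Finset.mem_sdiff.1 h').1
        · exact fun h' => (Finset.mem_sdiff.1 h').2 h
      simp only [unitRows, if_neg this]
    · simp
    · intro v hv j hj
      have : j ≠ ρ' v := fun h =>
        Finset.disjoint_right.1 hSB hj (h ▸ hρS ρ' hρ' v (Finset.mem_sdiff.1 hv).1)
      simp only [unitRows, if_pos hv, if_neg this]
  have hP : ∀ ρ' ∈ restrictedMaps S (fun _ => S), ∀ ρ ∈ restrictedMaps S (fun _ => S),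
      (if MapCyclicOn S (fun v => if v ∈ D then ρ v else ρ' v) then (1 : R) else 0) =
      ∑ b ∈ restrictedMaps S (fun _ => S), ∑ a ∈ restrictedMaps S (fun _ => S),
        (if MapCyclicOn S (fun v => if v ∈ D then b v else ρ' v) then 1 else 0) *
          algebraMap K R (G D b a) *
          (if MapCyclicOn S (fun v => if v ∈ D then ρ v else a v) then 1 else 0) := by
    intro ρ' hρ' ρ hρ
    have := congrArg (algebraMap K R) (hG D ρ' hρ' ρ hρ)
    simpa only [map_sum, map_mul, apply_ite (algebraMap K R), map_one, map_zero] using this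
  have hmain : mapSum MapCyclicOn (A ∪ S ∪ B) N =
      ∑ ρ ∈ restrictedMaps S (fun _ => S), ∑ ρ' ∈ restrictedMaps S (fun _ => S),
        ∑ b ∈ restrictedMaps S (fun _ => S), ∑ a ∈ restrictedMaps S (fun _ => S),
        TB ρ * TA ρ' * ((if MapCyclicOn S (fun v => if v ∈ D then b v else ρ' v) then 1 else 0) *
          algebraMap K R (G D b a) *
          (if MapCyclicOn S (fun v => if v ∈ D then ρ v else a v) then 1 else 0)) := by
    rw [hU]
    refine Finset.sum_congr rfl fun ρ hρ => ?_
    rw [hA ρ hρ, Finset.mul_sum]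
    refine Finset.sum_congr rfl fun ρ' hρ' => ?_
    rw [hP ρ' hρ' ρ hρ, Finset.mul_sum, Finset.mul_sum]
    refine Finset.sum_congr rfl fun b _ => ?_
    rw [Finset.mul_sum, Finset.mul_sum]
    exact Finset.sum_congr rfl fun a _ => by ring
  rw [hmain]
  have hright : ∀ b ∈ restrictedMaps S (fun _ => S), ∀ a ∈ restrictedMaps S (fun _ => S),
      algebraMap K R (G D b a) * (mapSum MapCyclicOn (A ∪ S) (unitRows D b N) *
        mapSum MapCyclicOn (B ∪ S) (unitRows (S \ D) a N)) =
      ∑ ρ ∈ restrictedMaps S (fun _ => S), ∑ ρ' ∈ restrictedMaps S (fun _ => S),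
        TB ρ * TA ρ' * ((if MapCyclicOn S (fun v => if v ∈ D then b v else ρ' v) then 1 else 0) *
          algebraMap K R (G D b a) *
          (if MapCyclicOn S (fun v => if v ∈ D then ρ v else a v) then 1 else 0)) := by
    intro b hb a ha
    rw [hA b hb, hB a ha, mul_comm (∑ _ ∈ _, _) (∑ _ ∈ _, _), Finset.sum_mul_sum,
      Finset.mul_sum]
    refine Finset.sum_congr rfl fun ρ _ => ?_
    rw [Finset.mul_sum]
    exact Finset.sum_congr rfl fun ρ' _ => by ring
  rw [Finset.sum_congr rfl fun b hb => Finset.sum_congr rfl fun a ha => hright b hb a ha]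
  refine (Finset.sum_congr rfl fun _ _ =>
    Finset.sum_comm.trans (Finset.sum_congr rfl fun _ _ => Finset.sum_comm)).trans ?_
  exact Finset.sum_comm.trans (Finset.sum_congr rfl fun _ _ => Finset.sum_comm)

/-! ### Balanced separators in tree decompositions -/

/-- A partition into parts of size at most half the total can be grouped into two balanced
halves. -/
theorem exists_balanced_grouping {V ι : Type} [DecidableEq V] [DecidableEq ι] (W : Finset V)
    (g : V → ι) {n : ℕ} (hW : W.card ≤ n) (hg : ∀ c, 2 * (W.filter fun v => g v = c).card ≤ n) :
    ∃ A B : Finset V, W = A ∪ B ∧ Disjoint A B ∧ (∀ a ∈ A, ∀ b ∈ B, g a ≠ g b) ∧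
      3 * A.card ≤ 2 * n ∧ 3 * B.card ≤ 2 * n := by
  have hsplit : ∀ J : Finset ι, (W.filter fun v => g v ∈ J).card +
      (W.filter fun v => g v ∉ J).card = W.card := fun J =>
    Finset.card_filter_add_card_filter_not _
  suffices h : ∃ J : Finset ι, 3 * (W.filter fun v => g v ∈ J).card ≤ 2 * n ∧
      3 * (W.filter fun v => g v ∉ J).card ≤ 2 * n by
    obtain ⟨J, h1, h2⟩ := h
    refine ⟨_, _, (Finset.filter_union_filter_not_eq (fun v => g v ∈ J) W).symm,
      Finset.disjoint_filter_filter_not _ _ _, ?_, h1, h2⟩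
    intro a ha b hb hab
    exact (Finset.mem_filter.1 hb).2 (hab ▸ (Finset.mem_filter.1 ha).2)
  by_cases hbig : ∃ c, n < 3 * (W.filter fun v => g v = c).card
  · obtain ⟨c, hc⟩ := hbig
    have h1 := hsplit {c}
    have h2 := hg c
    simp only [Finset.mem_singleton] at h1
    exact ⟨{c}, by simp only [Finset.mem_singleton]; omega, by
      simp only [Finset.mem_singleton]; omega⟩
  push Not at hbig
  obtain ⟨J, hJ, hmax⟩ := Finset.exists_max_image
    ((W.image g).powerset.filter fun J => 3 * (W.filter fun v => g v ∈ J).card ≤ 2 * n)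
    (fun J => (W.filter fun v => g v ∈ J).card) ⟨∅, by simp⟩
  simp only [Finset.mem_filter, Finset.mem_powerset] at hJ hmax
  refine ⟨J, hJ.2, ?_⟩
  by_contra! hcon
  have h1 := hsplit J
  obtain ⟨b, hb⟩ : (W.filter fun v => g v ∉ J).Nonempty := by
    rw [← Finset.card_pos]
    omega
  obtain ⟨hbW, hbJ⟩ := Finset.mem_filter.1 hb
  have hadd : (W.filter fun v => g v ∈ insert (g b) J).card =
      (W.filter fun v => g v ∈ J).card + (W.filter fun v => g v = g b).card := by
    rw [← Finset.card_union_of_disjoint]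
    · congr 1
      ext v
      simp only [Finset.mem_filter, Finset.mem_insert, Finset.mem_union]
      tauto
    · rw [Finset.disjoint_filter]
      intro v _ hv hvb
      exact hbJ (hvb ▸ hv)
  have hpos : 0 < (W.filter fun v => g v = g b).card :=
    Finset.card_pos.2 ⟨b, by simp [hbW]⟩
  have h3 := hbig (g b)
  have := hmax (insert (g b) J) ⟨Finset.insert_subset (Finset.mem_image_of_mem g hbW) hJ.1, by
    rw [hadd]; omega⟩
  omega

/-- The graph `T` with all the edges at `t` removed. -/
def isolate {ι : Type} (T : SimpleGraph ι) (t : ι) : SimpleGraph ι where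
  Adj a b := T.Adj a b ∧ a ≠ t ∧ b ≠ t
  symm := ⟨fun _ _ h => ⟨h.1.symm, h.2.2, h.2.1⟩⟩
  loopless := ⟨fun _ h => h.1.ne rfl⟩

theorem isolate_le_deleteEdges {ι : Type} (T : SimpleGraph ι) (t t' : ι) :
    isolate T t ≤ T.deleteEdges {s(t, t')} := by
  intro a b h
  rw [SimpleGraph.deleteEdges_adj]
  refine ⟨h.1, fun hab => ?_⟩
  rcases Sym2.eq_iff.1 (Set.mem_singleton_iff.1 hab) with h' | h'
  · exact h.2.1 h'.1
  · exact h.2.2 h'.2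

theorem exists_adj_reachable_isolate {ι : Type} {T : SimpleGraph ι} (hT : T.Connected)
    {t s : ι} (hst : s ≠ t) : ∃ t', T.Adj t t' ∧ (isolate T t).Reachable t' s := by
  have key : ∀ (a b : ι) (p : T.Walk a b), t ∉ p.support → (isolate T t).Reachable a b := by
    intro a b p
    induction p with
    | nil => exact fun _ => SimpleGraph.Reachable.refl _
    | cons h p ih =>
      intro ht
      rw [SimpleGraph.Walk.support_cons, List.mem_cons, not_or] at ht
      refine SimpleGraph.Reachable.trans (SimpleGraph.Adj.reachable ⟨h, Ne.symm ht.1, ?_⟩) (ih ht.2)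
      exact fun h' => ht.2 (h' ▸ p.start_mem_support)
  obtain ⟨p, hp⟩ := (hT.preconnected t s).exists_isPath
  cases p with
  | nil => exact absurd rfl hst
  | cons h p =>
    rw [SimpleGraph.Walk.cons_isPath_iff] at hp
    exact ⟨_, h, key _ _ p hp.2⟩

theorem reachable_isolate_of_mem {ι V : Type} {T : SimpleGraph ι} {X : ι → Finset V} {v : V}
    (hv : (T.induce {t | v ∈ X t}).Connected) {t s s' : ι} (ht : v ∉ X t) (hs : v ∈ X s)
    (hs' : v ∈ X s') : (isolate T t).Reachable s s' := by
  have hne : ∀ a : {t | v ∈ X t}, (a : ι) ≠ t := fun a h => ht (h ▸ a.2)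
  let φ : T.induce {t | v ∈ X t} →g isolate T t :=
    ⟨Subtype.val, fun {a b} h => ⟨h, hne a, hne b⟩⟩
  exact (hv.preconnected ⟨s, hs⟩ ⟨s', hs'⟩).map φ

theorem exists_centroid {ι V : Type} [Fintype ι] [DecidableEq V] {T : SimpleGraph ι}
    (hT : T.IsTree) {X : ι → Finset V} (bag : V → ι) (hbag : ∀ v, v ∈ X (bag v)) (U : Finset V) :
    ∃ t, ∀ c : (isolate T t).ConnectedComponent,
      2 * ((U \ X t).filter fun v =>
        (isolate T t).connectedComponentMk (bag v) = c).card ≤ U.card := by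
  by_contra! hcon
  choose c hc using hcon
  set F : ι → Finset V := fun t => (U \ X t).filter fun v =>
    (isolate T t).connectedComponentMk (bag v) = c t with hF
  replace hc : ∀ t, U.card < 2 * (F t).card := hc
  have hFU : ∀ t, F t ⊆ U := fun t => (Finset.filter_subset _ _).trans Finset.sdiff_subset
  have hnext : ∀ t, ∃ t', T.Adj t t' ∧ ∀ v ∈ F t,
      (T.deleteEdges {s(t, t')}).Reachable t' (bag v) := by
    intro t
    have hne : (F t).Nonempty := by
      rw [← Finset.card_pos]
      have := hc t
      omega
    obtain ⟨w, hw⟩ := hne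
    simp only [hF, Finset.mem_filter, Finset.mem_sdiff] at hw
    obtain ⟨t', ht', hreach⟩ := exists_adj_reachable_isolate hT.1 (t := t) (s := bag w)
      fun h => hw.1.2 (h ▸ hbag w)
    refine ⟨t', ht', fun v hv => ?_⟩
    simp only [hF, Finset.mem_filter] at hv
    refine (hreach.trans (SimpleGraph.ConnectedComponent.exact (hw.2.trans hv.2.symm))).mono ?_
    exact isolate_le_deleteEdges T t t'
  choose next hadj hnext using hnext
  have hlt : T.edgeFinset.card < (Finset.univ : Finset ι).card := by
    have := hT.card_edgeFinset
    rw [Finset.card_univ]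
    omega
  obtain ⟨t, -, u, -, htu, he⟩ := Finset.exists_ne_map_eq_of_card_lt_of_maps_to hlt
    (f := fun t => s(t, next t)) (fun t _ => by simpa using hadj t)
  rcases Sym2.eq_iff.1 he with h | ⟨h1, h2⟩
  · exact htu h.1
  obtain ⟨v, hv⟩ : (F t ∩ F u).Nonempty := by
    rw [← Finset.card_pos]
    have h3 := Finset.card_union_add_card_inter (F t) (F u)
    have h4 := Finset.card_le_card (Finset.union_subset (hFU t) (hFU u))
    have h5 := hc t
    have h6 := hc u
    omega
  obtain ⟨hvt, hvu⟩ := Finset.mem_inter.1 hv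
  have h3 := hnext t v hvt
  have h4 := hnext u v hvu
  rw [show s(u, next u) = s(t, next t) from he.symm, ← h1] at h4
  have hbridge := (SimpleGraph.isAcyclic_iff_forall_adj_isBridge.1 hT.2) (hadj t)
  rw [SimpleGraph.isBridge_iff] at hbridge
  exact hbridge (h4.trans h3.symm)

/-- Every set of vertices of a graph with a tree decomposition has a balanced separator contained
in a bag. -/
theorem exists_balanced_separator {ι V : Type} [Fintype ι] [DecidableEq V] {T : SimpleGraph ι}
    (hT : T.IsTree) {X : ι → Finset V} (hcover : ∀ v, ∃ t, v ∈ X t)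
    (hconn : ∀ v, (T.induce {t | v ∈ X t}).Connected) {U : Finset V} (hU : U.Nonempty) :
    ∃ (A S B : Finset V) (t : ι), U = A ∪ S ∪ B ∧ S.Nonempty ∧ S ⊆ X t ∧ Disjoint S A ∧
      Disjoint S B ∧ Disjoint A B ∧ (∀ a ∈ A, ∀ b ∈ B, ∀ s, ¬ (a ∈ X s ∧ b ∈ X s)) ∧
      3 * A.card ≤ 2 * U.card ∧ 3 * B.card ≤ 2 * U.card := by
  choose bag hbag using hcover
  obtain ⟨t, ht⟩ := exists_centroid hT bag hbag U
  obtain ⟨A, B, hW, hAB, hg, hA, hB⟩ := exists_balanced_grouping (U \ X t)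
    (fun v => (isolate T t).connectedComponentMk (bag v))
    (Finset.card_le_card Finset.sdiff_subset) ht
  have hA' : ∀ a ∈ A, a ∈ U ∧ a ∉ X t := fun a ha =>
    Finset.mem_sdiff.1 (hW ▸ Finset.mem_union_left _ ha)
  have hB' : ∀ b ∈ B, b ∈ U ∧ b ∉ X t := fun b hb =>
    Finset.mem_sdiff.1 (hW ▸ Finset.mem_union_right _ hb)
  have hsep : ∀ a ∈ A, ∀ b ∈ B, ∀ s, ¬ (a ∈ X s ∧ b ∈ X s) := by
    rintro a ha b hb s ⟨has, hbs⟩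
    refine hg a ha b hb (SimpleGraph.ConnectedComponent.sound ?_)
    exact (reachable_isolate_of_mem (hconn a) (hA' a ha).2 (hbag a) has).trans
      (reachable_isolate_of_mem (hconn b) (hB' b hb).2 hbs (hbag b))
  obtain ⟨S, t', hS, hSU, hSt, hUS⟩ : ∃ (S : Finset V) (t' : ι), S.Nonempty ∧ S ⊆ U ∧ S ⊆ X t' ∧
      U ∩ X t ⊆ S := by
    by_cases h : (U ∩ X t).Nonempty
    · exact ⟨U ∩ X t, t, h, Finset.inter_subset_left, Finset.inter_subset_right, subset_rfl⟩
    · obtain ⟨s, hs⟩ := hU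
      rw [Finset.not_nonempty_iff_eq_empty] at h
      exact ⟨{s}, bag s, Finset.singleton_nonempty s, Finset.singleton_subset_iff.2 hs,
        Finset.singleton_subset_iff.2 (hbag s), by simp [h]⟩
  refine ⟨A \ S, S, B \ S, t', ?_, hS, hSt, Finset.disjoint_sdiff, Finset.disjoint_sdiff,
    hAB.mono Finset.sdiff_subset Finset.sdiff_subset,
    fun a ha b hb => hsep a (Finset.mem_sdiff.1 ha).1 b (Finset.mem_sdiff.1 hb).1,
    ?_, ?_⟩
  · ext v
    have h1 : v ∈ U \ X t ↔ v ∈ A ∪ B := by rw [hW]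
    have h2 : v ∈ U ∩ X t → v ∈ S := fun h => hUS h
    have h3 : v ∈ S → v ∈ U := fun h => hSU h
    simp only [Finset.mem_sdiff, Finset.mem_union, Finset.mem_inter] at h1 h2 ⊢
    by_cases hvS : v ∈ S
    · simp [hvS, h3 hvS]
    · simp only [hvS, imp_false, not_and, not_false_eq_true, and_true, or_false] at h2 ⊢
      rw [← h1]
      exact ⟨fun h => ⟨h, h2 h⟩, fun h => h.1⟩
  · have := Finset.card_le_card (Finset.sdiff_subset (s := A) (t := S))
    omega
  · have := Finset.card_le_card (Finset.sdiff_subset (s := B) (t := S))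
    omega

/-! ### Formulas for hamiltonians of matrices of bounded treewidth -/

/-- The polynomial `p` has a formula of size at most `L`. -/
def HasFormula {K ν : Type} [CommRing K] (L : ℕ) (p : MvPolynomial ν K) : Prop :=
  ∃ φ : Formula K ν, φ.size ≤ L ∧ φ.toPoly = p

theorem HasFormula.mono {K ν : Type} [CommRing K] {L L' : ℕ} {p : MvPolynomial ν K}
    (h : HasFormula L p) (hL : L ≤ L') : HasFormula L' p :=
  let ⟨φ, h1, h2⟩ := h
  ⟨φ, h1.trans hL, h2⟩

theorem hasFormula_C {K ν : Type} [CommRing K] (a : K) :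
    HasFormula 1 (MvPolynomial.C a : MvPolynomial ν K) :=
  ⟨.const a, le_rfl, rfl⟩

theorem IsEntry.hasFormula {K ν : Type} [CommRing K] {p : MvPolynomial ν K} (h : IsEntry p) :
    HasFormula 1 p := by
  rcases h with ⟨a, rfl⟩ | ⟨v, rfl⟩
  · exact hasFormula_C a
  · exact ⟨.var v, le_rfl, rfl⟩

theorem HasFormula.add {K ν : Type} [CommRing K] {L L' : ℕ} {p q : MvPolynomial ν K}
    (hp : HasFormula L p) (hq : HasFormula L' q) : HasFormula (L + L' + 1) (p + q) := by
  obtain ⟨φ, h1, rfl⟩ := hp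
  obtain ⟨ψ, h2, rfl⟩ := hq
  exact ⟨φ.add ψ, by simp only [Formula.size]; omega, rfl⟩

theorem HasFormula.mul {K ν : Type} [CommRing K] {L L' : ℕ} {p q : MvPolynomial ν K}
    (hp : HasFormula L p) (hq : HasFormula L' q) : HasFormula (L + L' + 1) (p * q) := by
  obtain ⟨φ, h1, rfl⟩ := hp
  obtain ⟨ψ, h2, rfl⟩ := hq
  exact ⟨φ.mul ψ, by simp only [Formula.size]; omega, rfl⟩

theorem HasFormula.sum {K ν ι : Type} [CommRing K] {L : ℕ} (s : Finset ι)
    {p : ι → MvPolynomial ν K} (h : ∀ i ∈ s, HasFormula L (p i)) :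
    HasFormula (s.card * (L + 1) + 1) (∑ i ∈ s, p i) := by
  induction s using Finset.induction_on with
  | empty => simpa using hasFormula_C (0 : K)
  | insert a s ha ih =>
    rw [Finset.sum_insert ha, Finset.card_insert_of_notMem ha]
    refine ((h a (by simp)).add (ih fun i hi => h i (by simp [hi]))).mono (le_of_eq ?_)
    ring

theorem HasFormula.prod {K ν ι : Type} [CommRing K] {L : ℕ} (s : Finset ι)
    {p : ι → MvPolynomial ν K} (h : ∀ i ∈ s, HasFormula L (p i)) :
    HasFormula (s.card * (L + 1) + 1) (∏ i ∈ s, p i) := by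
  induction s using Finset.induction_on with
  | empty => simpa using hasFormula_C (1 : K)
  | insert a s ha ih =>
    rw [Finset.prod_insert ha, Finset.card_insert_of_notMem ha]
    refine ((h a (by simp)).mul (ih fun i hi => h i (by simp [hi]))).mono (le_of_eq ?_)
    ring

theorem card_restrictedMaps {V : Type} [Fintype V] [DecidableEq V] (U S : Finset V) :
    (restrictedMaps U fun _ => S).card = S.card ^ U.card := by
  rw [restrictedMaps, Fintype.card_piFinset, ← Finset.prod_subset (Finset.subset_univ U)]
  · rw [Finset.prod_congr rfl fun v hv => by rw [if_pos hv], Finset.prod_const]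
  · intro v _ hv
    simp [hv]

theorem hasFormula_mapSum {K ν V : Type} [CommRing K] [Fintype V] [DecidableEq V]
    {P : Finset V → (V → V) → Prop} (hP : IsInsertable P) (U : Finset V)
    {M : V → V → MvPolynomial ν K} (hM : ∀ i j, IsEntry (M i j)) :
    HasFormula (U.card ^ U.card * (U.card * 2 + 2) + 1) (mapSum P U M) := by
  refine (HasFormula.sum (selfMaps P U) fun f _ =>
    HasFormula.prod U fun v _ => (hM v (f v)).hasFormula).mono ?_
  have : (selfMaps P U).card ≤ U.card ^ U.card := by
    rw [← card_restrictedMaps]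
    refine Finset.card_le_card fun f hf => ?_
    simp only [selfMaps, Finset.mem_filter, Finset.mem_univ, true_and] at hf
    exact mem_restrictedMaps.2 ⟨(hP.mapPermOn hf.2).1, hf.1⟩
  gcongr

theorem IsEntry.unitRows_sepRows {K ν V : Type} [CommRing K] [DecidableEq V]
    {M : V → V → MvPolynomial ν K} (hM : ∀ i j, IsEntry (M i j)) (S B D E : Finset V)
    (ρ : V → V) (i j : V) : IsEntry (unitRows E ρ (sepRows S B D M) i j) := by
  unfold unitRows sepRows
  split_ifs
  · exact isEntry_one
  · exact isEntry_zero
  · exact hM i j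
  · exact isEntry_zero
  · exact isEntry_zero
  · exact hM i j
  · exact hM i j

theorem unitRows_sepRows_covered {R ι V : Type} [CommRing R] [DecidableEq V]
    {X : ι → Finset V} {M : V → V → R}
    (hM : ∀ a b, a ≠ b → M a b ≠ 0 → ∃ t, a ∈ X t ∧ b ∈ X t) {S B D E : Finset V} {t : ι}
    (hSt : S ⊆ X t) (hES : E ⊆ S) {ρ : V → V} (hρ : ∀ v ∈ S, ρ v ∈ S) (a b : V) (hab : a ≠ b)
    (h : unitRows E ρ (sepRows S B D M) a b ≠ 0) : ∃ t, a ∈ X t ∧ b ∈ X t := by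
  by_cases ha : a ∈ E
  · have hb : b = ρ a := by
      by_contra hb
      exact h (by simp [unitRows, ha, hb])
    exact ⟨t, hSt (hES ha), hSt (hb ▸ hρ a (hES ha))⟩
  · refine hM a b hab fun h0 => h ?_
    simp [unitRows, ha, sepRows, h0]

/-- The size bound for hamiltonians of small matrices. -/
def hamBaseBound (k : ℕ) : ℕ :=
  (12 * (k + 1)) ^ (12 * (k + 1)) * (12 * (k + 1) * 2 + 2) + 1

theorem exists_pow_bound (Q : ℕ) : ∃ e : ℕ, Q * 3 ^ e ≤ 4 ^ e := by
  obtain ⟨e, he⟩ := pow_unbounded_of_one_lt (Q : ℚ) (show (1 : ℚ) < 4 / 3 by norm_num)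
  refine ⟨e, ?_⟩
  rw [div_pow, lt_div_iff₀ (by positivity)] at he
  exact_mod_cast he.le

theorem separator_size_bound {p r L P R : ℕ} (hp : p ≤ P) (hr : r ≤ R) (hP : 1 ≤ P) (hR : 1 ≤ R)
    (hL : 1 ≤ L) :
    p * (r * (r * (1 + (L + L + 1) + 1 + 1) + 1 + 1) + 1 + 1) + 1 ≤ 11 * P * R ^ 2 * L := by
  have h1 : r * (1 + (L + L + 1) + 1 + 1) + 1 + 1 ≤ 8 * (R * L) := by nlinarith
  have h2 : r * (r * (1 + (L + L + 1) + 1 + 1) + 1 + 1) + 1 + 1 ≤ 10 * (R * (R * L)) := by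
    nlinarith [Nat.mul_le_mul hr h1, Nat.mul_le_mul hR (Nat.mul_le_mul hR hL)]
  nlinarith [Nat.mul_le_mul hp h2, Nat.mul_le_mul hP (Nat.mul_le_mul hR (Nat.mul_le_mul hR hL))]

theorem hasFormula_mapCyclicOn {K ν ι V : Type} [Field K] [Fintype ι] [Fintype V] [DecidableEq V]
    {k e : ℕ} (he : 11 * 2 ^ (k + 1) * ((k + 1) ^ (k + 1)) ^ 2 * 3 ^ e ≤ 4 ^ e)
    {T : SimpleGraph ι} (hT : T.IsTree) {X : ι → Finset V} (hX : ∀ t, (X t).card ≤ k + 1)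
    (hcover : ∀ v, ∃ t, v ∈ X t) (hconn : ∀ v, (T.induce {t | v ∈ X t}).Connected)
    (U : Finset V) (hU : U.Nonempty) (M : V → V → MvPolynomial ν K)
    (hM : ∀ i j, IsEntry (M i j))
    (hMX : ∀ a b, a ≠ b → M a b ≠ 0 → ∃ t, a ∈ X t ∧ b ∈ X t) :
    HasFormula (hamBaseBound k * U.card ^ e) (mapSum MapCyclicOn U M) := by
  induction hu : U.card using Nat.strong_induction_on generalizing U M with
  | h u ih =>
  subst hu
  have hUpos : 0 < U.card := Finset.card_pos.2 hU
  by_cases hsmall : U.card ≤ 12 * (k + 1)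
  · refine (hasFormula_mapSum isInsertable_mapCyclicOn U hM).mono ?_
    calc U.card ^ U.card * (U.card * 2 + 2) + 1 ≤ hamBaseBound k := by
          unfold hamBaseBound
          have h1 : U.card ^ U.card ≤ (12 * (k + 1)) ^ (12 * (k + 1)) :=
            (Nat.pow_le_pow_left hsmall _).trans (Nat.pow_le_pow_right (by omega) hsmall)
          gcongr
      _ ≤ hamBaseBound k * U.card ^ e := Nat.le_mul_of_pos_right _ (by positivity)
  push Not at hsmall
  obtain ⟨A, S, B, t, hUS, hS, hSt, hSA, hSB, hAB, hsep, hA, hB⟩ :=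
    exists_balanced_separator hT hcover hconn hU
  have hSk : S.card ≤ k + 1 := (Finset.card_le_card hSt).trans (hX t)
  have hSpos : 0 < S.card := Finset.card_pos.2 hS
  obtain ⟨G, hG⟩ := mapSum_separator (K := K) hS hSA hSB hAB (M := M) (by
    intro a ha b hb
    have hab : a ≠ b := fun h => Finset.disjoint_left.1 hAB ha (h ▸ hb)
    constructor
    · by_contra h0
      obtain ⟨s, h1, h2⟩ := hMX a b hab h0
      exact hsep a ha b hb s ⟨h1, h2⟩
    · by_contra h0
      obtain ⟨s, h1, h2⟩ := hMX b a hab.symm h0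
      exact hsep a ha b hb s ⟨h2, h1⟩)
  rw [← hUS] at hG
  rw [hG]
  set u' := 3 * U.card / 4 with hu'
  set L := hamBaseBound k * u' ^ e with hL
  have hrec : ∀ A' : Finset V, 3 * A'.card ≤ 2 * U.card → ∀ D E : Finset V, E ⊆ S →
      ∀ ρ ∈ restrictedMaps S (fun _ => S),
      HasFormula L (mapSum MapCyclicOn (A' ∪ S) (unitRows E ρ (sepRows S B D M))) := by
    intro A' hA' D E hE ρ hρ
    have hcard := Finset.card_union_le A' S
    have hle : (A' ∪ S).card ≤ u' := by omega
    refine (ih (A' ∪ S).card (by omega) (A' ∪ S) (hS.mono Finset.subset_union_right) _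
      (IsEntry.unitRows_sepRows hM S B D E ρ)
      (unitRows_sepRows_covered hMX hSt hE (mem_restrictedMaps.1 hρ).1) rfl).mono ?_
    rw [hL]
    gcongr
  have hform := HasFormula.sum S.powerset fun D hD =>
    HasFormula.sum (restrictedMaps S fun _ => S) fun ρ hρ =>
      HasFormula.sum (restrictedMaps S fun _ => S) fun ρ' hρ' =>
        (hasFormula_C (ν := ν) (G D ρ ρ')).mul
          ((hrec A hA D D (Finset.mem_powerset.1 hD) ρ hρ).mul
            (hrec B hB D (S \ D) Finset.sdiff_subset ρ' hρ'))
  refine hform.mono ?_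
  rw [card_restrictedMaps, Finset.card_powerset]
  have hu'pos : 0 < u' := by omega
  have hLpos : 1 ≤ L := Nat.mul_pos (by unfold hamBaseBound; omega) (Nat.pow_pos hu'pos)
  refine (separator_size_bound (Nat.pow_le_pow_right two_pos hSk)
    ((Nat.pow_le_pow_left hSk _).trans (Nat.pow_le_pow_right (by omega) hSk))
    (Nat.one_le_two_pow) (Nat.one_le_pow _ _ (by omega)) hLpos).trans ?_
  have h4 : 4 ^ e * u' ^ e ≤ 3 ^ e * U.card ^ e := by
    rw [← mul_pow, ← mul_pow]
    exact Nat.pow_le_pow_left (by omega) _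
  refine le_of_mul_le_mul_left ?_ (show 0 < 4 ^ e by positivity)
  set Q := 11 * 2 ^ (k + 1) * ((k + 1) ^ (k + 1)) ^ 2 with hQ
  calc 4 ^ e * (Q * L) = Q * hamBaseBound k * (4 ^ e * u' ^ e) := by rw [hL]; ring
    _ ≤ Q * hamBaseBound k * (3 ^ e * U.card ^ e) := by gcongr
    _ = (Q * 3 ^ e) * (hamBaseBound k * U.card ^ e) := by ring
    _ ≤ 4 ^ e * (hamBaseBound k * U.card ^ e) := by gcongr

theorem HamClass.formulaClass {K : Type} [Field K] {f : ℕ → MvPolynomial ℕ K}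
    (h : HamClass K f) : FormulaClass K f := by
  obtain ⟨c, k, h⟩ := h
  obtain ⟨e, he⟩ := exists_pow_bound (11 * 2 ^ (k + 1) * ((k + 1) ^ (k + 1)) ^ 2)
  have key : ∀ n, HasFormula (hamBaseBound k * (c * (n + 1) ^ c) ^ e + 1) (f n) := by
    intro n
    obtain ⟨m, hm, M, hM, ⟨N, T, X, hT, hX, hcover, hadj, hconn⟩, hf⟩ := h n
    rw [← hf]
    by_cases hm2 : 2 ≤ m
    · rw [ham_eq_mapSum hm2]
      have : NeZero m := ⟨by omega⟩
      refine (hasFormula_mapCyclicOn he hT hX hcover hconn Finset.univ Finset.univ_nonempty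
        (fun i j => M i j) hM ?_).mono ?_
      · intro a b hab h0
        exact hadj a b (by
          simp only [supportGraph, SimpleGraph.fromRel_adj]
          exact ⟨hab, Or.inl h0⟩)
      · rw [Finset.card_univ, Fintype.card_fin]
        refine le_trans ?_ (Nat.le_succ _)
        gcongr
    · rw [ham_eq_zero (by omega)]
      exact (map_zero (MvPolynomial.C : K →+* MvPolynomial ℕ K) ▸
        hasFormula_C (0 : K)).mono (by omega)
  refine ⟨hamBaseBound k * c ^ e + 1 + c * e, fun n => ?_⟩
  obtain ⟨φ, hφ, hp⟩ := key n
  refine ⟨φ, hφ.trans ?_, hp⟩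
  set C := hamBaseBound k * c ^ e + 1 + c * e with hC
  have h1 : 1 ≤ (n + 1) ^ C := Nat.one_le_pow _ _ (by omega)
  have h2 : (n + 1) ^ (c * e) ≤ (n + 1) ^ C := Nat.pow_le_pow_right (by omega) (by omega)
  calc hamBaseBound k * (c * (n + 1) ^ c) ^ e + 1
      = hamBaseBound k * c ^ e * (n + 1) ^ (c * e) + 1 := by rw [mul_pow, ← pow_mul]; ring
    _ ≤ hamBaseBound k * c ^ e * (n + 1) ^ C + (n + 1) ^ C := by gcongr
    _ = (hamBaseBound k * c ^ e + 1) * (n + 1) ^ C := by ring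
    _ ≤ C * (n + 1) ^ C := by gcongr; omega

/-- if the polynomial-size-formula class is closed under taking permanents
of polynomial size bounded treewidth matrices with entries 0, 1 or variables, then the
formula, bounded-treewidth-permanent and bounded-treewidth-hamiltonian classes
coincide. -/
theorem treewidth_characterization
    (hclosed : ∀ f : ℕ → MvPolynomial ℕ K, Perm01Class K f → FormulaClass K f) :
    ∀ f : ℕ → MvPolynomial ℕ K,
      (FormulaClass K f ↔ PermClass K f) ∧ (FormulaClass K f ↔ HamClass K f) := by
  intro f
  exact ⟨⟨FormulaClass.permClass, PermClass.formulaClass hclosed⟩,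
    ⟨FormulaClass.hamClass, HamClass.formulaClass⟩⟩
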